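/- arXiv:2004.14741 — 2 statements merged into one kernel-verified Lean document; each statement's English description precedes it below -/
import Mathlib

section
/- For k = 2, the quantity (1-δ)^{-1}·√(πnδ(1-δ/2))·λ(n,2,δ) converges to 1 as nδ → ∞; that is, for every ε > 0 there exists M such that for all n ≥ 2 and all δ ∈ (0,1) with nδ ≥ M, one has |(1-δ)^{-1}·√(πnδ(1-δ/2))·λ(n,2,δ) - 1| < ε. -/
open Finset

/-- `perturbW k δ a j` is the probability that the `δ`-perturbation of the pure
action `a ∈ [k]` plays the action `j`: with probability `1-δ` play `a`, with
probability `δ` play uniformly in `[k]`. -/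
noncomputable def perturbW (k : ℕ) (δ : ℝ) (a j : Fin k) : ℝ :=
  (1 - δ) * (if j = a then 1 else 0) + δ / k

/-- Probability that the (independent) `δ`-perturbation of the pure profile `a`
realises as the pure profile `b`. -/
noncomputable def profW (n k : ℕ) (δ : ℝ) (a b : Fin n → Fin k) : ℝ :=
  ∏ i, perturbW k δ (a i) (b i)

/-- A game: payoffs lie in `[0,1]`. -/
def IsGame (n k : ℕ) (g : (Fin n → Fin k) → Fin n → ℝ) : Prop :=
  ∀ a i, g a i ∈ Set.Icc (0 : ℝ) 1

/-- The number of players taking action `j` in the profile `a`. -/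
def actCount (n k : ℕ) (a : Fin n → Fin k) (j : Fin k) : ℕ :=
  (Finset.univ.filter fun i => a i = j).card

/-- A game is anonymous if each player's payoff depends only on his own action and
on the number of players taking each action. -/
def IsAnonymous (n k : ℕ) (g : (Fin n → Fin k) → Fin n → ℝ) : Prop :=
  ∀ (a b : Fin n → Fin k) (i : Fin n), a i = b i →
    (∀ j, actCount n k a j = actCount n k b j) → g a i = g b i

/-- The `δ`-perturbed game `g^δ`. -/
noncomputable def perturbGame (n k : ℕ) (δ : ℝ) (g : (Fin n → Fin k) → Fin n → ℝ) :
    (Fin n → Fin k) → Fin n → ℝ :=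
  fun a i => ∑ b : Fin n → Fin k, profW n k δ a b * g b i

/-- The Lipschitz constant of a game: the largest change of some player's payoff
when a single opponent changes his action. -/
noncomputable def lipC (n k : ℕ) (g : (Fin n → Fin k) → Fin n → ℝ) : ℝ :=
  sSup {x | ∃ (i : Fin n) (a b : Fin n → Fin k), a i = b i ∧
    (Finset.univ.filter fun j => a j ≠ b j).card = 1 ∧ x = |g a i - g b i|}

/-- The worst-case Lipschitz constant of `δ`-perturbed `n`-player `k`-action
anonymous games. -/
noncomputable def lam (n k : ℕ) (δ : ℝ) : ℝ :=
  sSup {x | ∃ g : (Fin n → Fin k) → Fin n → ℝ,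
    IsGame n k g ∧ IsAnonymous n k g ∧ x = lipC n k (perturbGame n k δ g)}
/-- `walk r m z` is the probability that the lazy symmetric random walk on `ℤ` with
rate `r` (i.i.d. increments: `0` w.p. `1-r`, `±1` w.p. `r/2` each), started at `0`,
is at `z` after `m` steps; i.e. `P(S_m^r = z)`. -/
noncomputable def walk (r : ℝ) : ℕ → ℤ → ℝ
  | 0, z => if z = 0 then 1 else 0
  | m + 1, z => (1 - r) * walk r m z + r / 2 * walk r m (z - 1) + r / 2 * walk r m (z + 1)

/-- The average over a period of `(1 - r (1 - cos t)) ^ (N / 2)`, the modulus of the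
characteristic function of a sum of `N` independent Bernoulli variables of variance `r / 2`. -/
noncomputable def charAverage (N : ℕ) (r : ℝ) : ℝ :=
  (2 * Real.pi)⁻¹ * ∫ t in -Real.pi..Real.pi, √(1 - r * (1 - Real.cos t)) ^ N

section Asymptotics

open Filter Topology MeasureTheory

theorem tendsto_sq_mul_one_sub_cos_div {ι : Type*} {l : Filter ι} {c : ι → ℝ}
    (hc : Tendsto c l atTop) (u : ℝ) :
    Tendsto (fun x => c x ^ 2 * (1 - Real.cos (u / c x))) l (𝓝 (u ^ 2 / 2)) := by
  have h1 : Tendsto (fun x => u / 2 / c x) l (𝓝 0) := hc.const_div_atTop _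
  have h2 : Tendsto (fun x => u ^ 2 / 2 * Real.sinc (u / 2 / c x) ^ 2) l (𝓝 (u ^ 2 / 2)) := by
    have := (((Real.continuous_sinc.tendsto 0).comp h1).pow 2).const_mul (u ^ 2 / 2)
    simpa using this
  refine h2.congr' ?_
  filter_upwards [hc.eventually_gt_atTop 0] with x hx
  rcases eq_or_ne u 0 with rfl | hu
  · simp
  have hne : u / 2 / c x ≠ 0 := by positivity
  have e : u / c x = 2 * (u / 2 / c x) := by ring
  rw [e, Real.cos_two_mul, Real.cos_sq', Real.sinc_of_ne_zero hne]
  field_simp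
  ring

theorem tendsto_one_sub_pow_exp_neg {ι : Type*} {l : Filter ι} {N : ι → ℕ} {y : ι → ℝ} {a : ℝ}
    (hy : Tendsto y l (𝓝 0)) (hN : Tendsto (fun x => N x * y x) l (𝓝 a)) :
    Tendsto (fun x => (1 - y x) ^ N x) l (𝓝 (Real.exp (-a))) := by
  have hlt : ∀ᶠ x in l, y x < 1 := hy.eventually_lt_const one_pos
  have hlow : Tendsto (fun x => Real.exp (-(N x * y x / (1 - y x)))) l (𝓝 (Real.exp (-a))) := by
    have : Tendsto (fun x => -(N x * y x / (1 - y x))) l (𝓝 (-(a / (1 - 0)))) :=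
      (hN.div (hy.const_sub 1) (by norm_num)).neg
    simpa [Function.comp_def] using (Real.continuous_exp.tendsto _).comp this
  have hup : Tendsto (fun x => Real.exp (-(N x * y x))) l (𝓝 (Real.exp (-a))) :=
    (Real.continuous_exp.tendsto _).comp hN.neg
  refine tendsto_of_tendsto_of_tendsto_of_le_of_le' hlow hup ?_ ?_
  · filter_upwards [hlt] with x hx
    have hpos : 0 < 1 - y x := by linarith
    have h := Real.one_sub_inv_le_log_of_pos hpos
    have e : -(N x * y x / (1 - y x)) = N x * (1 - (1 - y x)⁻¹) := by
      field_simp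
      ring
    rw [e, Real.exp_nat_mul]
    gcongr
    exact (Real.le_log_iff_exp_le hpos).1 h
  · filter_upwards [hlt] with x hx
    have e : -(N x * y x) = N x * (-y x) := by ring
    rw [e, Real.exp_nat_mul]
    refine pow_le_pow_left₀ (by linarith) ?_ _
    linarith [Real.add_one_le_exp (-y x)]

theorem sqrt_one_sub_pow_le {N : ℕ} {r t : ℝ} (hr : 0 ≤ r) (ht : |t| ≤ Real.pi) :
    √(1 - r * (1 - Real.cos t)) ^ N ≤ Real.exp (-(1 / Real.pi ^ 2) * (N * r * t ^ 2)) := by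
  have h := Real.cos_le_one_sub_mul_cos_sq ht
  have e : -(1 / Real.pi ^ 2) * (N * r * t ^ 2) = N * (-(r * (2 / Real.pi ^ 2 * t ^ 2)) / 2) := by
    ring
  rw [e, Real.exp_nat_mul]
  gcongr
  rw [Real.exp_half]
  apply Real.sqrt_le_sqrt
  have h2 := Real.add_one_le_exp (-(r * (2 / Real.pi ^ 2 * t ^ 2)))
  have h3 := mul_le_mul_of_nonneg_left h hr
  linarith

theorem tendsto_sqrt_mul_charAverage {ι : Type*} {l : Filter ι} [l.IsCountablyGenerated]
    {N : ι → ℕ} {r : ι → ℝ} (hr : ∀ᶠ x in l, 0 < r x ∧ r x ≤ 1 / 2)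
    (h : Tendsto (fun x => N x * r x) l atTop) :
    Tendsto (fun x => √(Real.pi * (N x * r x)) * charAverage (N x) (r x)) l (𝓝 1) := by
  set c : ι → ℝ := fun x => √(N x * r x) with hcdef
  have hc : Tendsto c l atTop := Real.tendsto_sqrt_atTop.comp h
  have hcpos : ∀ᶠ x in l, 0 < c x := hc.eventually_gt_atTop 0
  have hcsq : ∀ᶠ x in l, c x ^ 2 = N x * r x := by
    filter_upwards [h.eventually_ge_atTop 0] with x hx
    exact Real.sq_sqrt hx
  set F : ι → ℝ → ℝ := fun x => (Set.Ioc (-Real.pi * c x) (Real.pi * c x)).indicator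
    (fun u => √(1 - r x * (1 - Real.cos (u / c x))) ^ N x) with hF
  have hlim : Tendsto (fun x => ∫ u, F x u) l (𝓝 (∫ u : ℝ, Real.exp (-(1 / 4) * u ^ 2))) := by
    refine tendsto_integral_filter_of_dominated_convergence
      (fun u => Real.exp (-(1 / Real.pi ^ 2) * u ^ 2)) ?_ ?_
      (integrable_exp_neg_mul_sq (by positivity)) ?_
    · refine Eventually.of_forall fun x => ?_
      refine AEStronglyMeasurable.indicator ?_ measurableSet_Ioc
      exact Continuous.aestronglyMeasurable (by fun_prop)
    · filter_upwards [hr, hcpos, hcsq] with x hrx hcx hsq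
      refine Eventually.of_forall fun u => ?_
      rw [hF, Real.norm_eq_abs]
      by_cases hu : u ∈ Set.Ioc (-Real.pi * c x) (Real.pi * c x)
      · simp only [Set.indicator_of_mem hu]
        rw [abs_of_nonneg (by positivity)]
        refine (sqrt_one_sub_pow_le hrx.1.le ?_).trans_eq ?_
        · rw [abs_le, le_div_iff₀ hcx, div_le_iff₀ hcx]
          exact ⟨hu.1.le, hu.2⟩
        · rw [← hsq]
          field_simp
      · simp only [Set.indicator_of_notMem hu, abs_zero]
        positivity
    · refine Eventually.of_forall fun u => ?_
      have hNy := tendsto_sq_mul_one_sub_cos_div hc u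
      have hN : Tendsto (fun x => (N x : ℝ)) l atTop := by
        refine tendsto_atTop_mono' l ?_ h
        filter_upwards [hr] with x hrx
        have : (0 : ℝ) ≤ N x := by positivity
        nlinarith
      have hNy' : Tendsto (fun x => N x * (r x * (1 - Real.cos (u / c x)))) l
          (𝓝 (u ^ 2 / 2)) := by
        refine hNy.congr' ?_
        filter_upwards [hcsq] with x hx
        rw [hx]
        ring
      have hy : Tendsto (fun x => r x * (1 - Real.cos (u / c x))) l (𝓝 0) := by
        refine (hNy'.div_atTop hN).congr' ?_
        filter_upwards [hN.eventually_gt_atTop 0] with x hx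
        field_simp
      have hpow := tendsto_one_sub_pow_exp_neg hy hNy'
      have hs := (Real.continuous_sqrt.tendsto _).comp hpow
      have e : √(Real.exp (-(u ^ 2 / 2))) = Real.exp (-(1 / 4) * u ^ 2) := by
        rw [← Real.exp_half]
        ring_nf
      rw [e] at hs
      refine hs.congr' ?_
      filter_upwards [hr, hcpos, hc.eventually_gt_atTop (|u|)] with x hrx hcx hux
      have hmem : u ∈ Set.Ioc (-Real.pi * c x) (Real.pi * c x) := by
        have h3 := Real.pi_gt_three
        have := abs_lt.1 hux
        constructor <;> nlinarith
      have hnn : 0 ≤ 1 - r x * (1 - Real.cos (u / c x)) := by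
        have := Real.neg_one_le_cos (u / c x)
        nlinarith
      simp only [hF, Set.indicator_of_mem hmem, Function.comp]
      rw [Real.sqrt_eq_iff_mul_self_eq (by positivity) (by positivity), ← mul_pow,
        Real.mul_self_sqrt hnn]
  have hval : ∫ u : ℝ, Real.exp (-(1 / 4) * u ^ 2) = 2 * √Real.pi := by
    rw [integral_gaussian, show Real.pi / (1 / 4) = 2 ^ 2 * Real.pi by ring,
      Real.sqrt_mul (by norm_num), Real.sqrt_sq (by norm_num)]
  rw [hval] at hlim
  have hlim2 := hlim.const_mul (√Real.pi * (2 * Real.pi)⁻¹)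
  have e1 : √Real.pi * (2 * Real.pi)⁻¹ * (2 * √Real.pi) = 1 := by
    have := Real.mul_self_sqrt Real.pi_pos.le
    have hp := Real.pi_pos
    field_simp
    linarith
  rw [e1] at hlim2
  refine hlim2.congr' ?_
  filter_upwards [hcpos] with x hcx
  have hle : -Real.pi * c x ≤ Real.pi * c x := by nlinarith [Real.pi_pos]
  have hscale := intervalIntegral.integral_comp_div (a := -Real.pi * c x) (b := Real.pi * c x)
    (fun t => √(1 - r x * (1 - Real.cos t)) ^ N x) hcx.ne'
  rw [mul_div_cancel_right₀ _ hcx.ne', mul_div_cancel_right₀ _ hcx.ne',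
    intervalIntegral.integral_of_le hle, smul_eq_mul] at hscale
  rw [hF]
  simp only
  rw [integral_indicator measurableSet_Ioc, hscale, charAverage, Real.sqrt_mul Real.pi_pos.le]
  ring

theorem charAverage_antitone {r : ℝ} (hr0 : 0 ≤ r) : Antitone fun N => charAverage N r := by
  intro M N hMN
  have hpi := Real.pi_pos
  simp only [charAverage]
  gcongr
  refine intervalIntegral.integral_mono_on (by linarith) ?_ ?_ fun t _ => ?_
  · exact Continuous.intervalIntegrable (by fun_prop) _ _
  · exact Continuous.intervalIntegrable (by fun_prop) _ _
  · refine pow_le_pow_of_le_one (by positivity) ?_ hMN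
    rw [Real.sqrt_le_iff]
    refine ⟨zero_le_one, ?_⟩
    nlinarith [Real.cos_le_one t]

theorem charAverage_nonneg (N : ℕ) (r : ℝ) : 0 ≤ charAverage N r := by
  have hpi := Real.pi_pos
  refine mul_nonneg (by positivity) (intervalIntegral.integral_nonneg (by linarith) ?_)
  intros
  positivity

end Asymptotics

section GeneratingPolynomials

open Polynomial

/-- The linear functional on polynomials that sends `X ^ m` to `h m`. -/
noncomputable def expectCoeff (h : ℕ → ℝ) : ℝ[X] →ₗ[ℝ] ℝ :=
  Polynomial.lsum fun m => h m • LinearMap.id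

theorem expectCoeff_monomial (h : ℕ → ℝ) (m : ℕ) (a : ℝ) :
    expectCoeff h (monomial m a) = h m * a := by
  simp [expectCoeff, Polynomial.lsum_apply]

theorem expectCoeff_X_mul (h : ℕ → ℝ) (p : ℝ[X]) :
    expectCoeff h (X * p) = expectCoeff (fun m => h (m + 1)) p := by
  induction p using Polynomial.induction_on' with
  | add p q hp hq => rw [mul_add, map_add, map_add, hp, hq]
  | monomial m a => rw [X_mul_monomial, expectCoeff_monomial, expectCoeff_monomial]

theorem expectCoeff_X_pow_mul (h : ℕ → ℝ) (c : ℕ) (p : ℝ[X]) :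
    expectCoeff h (X ^ c * p) = expectCoeff (fun m => h (m + c)) p := by
  induction c generalizing h with
  | zero => simp
  | succ c ih =>
    rw [pow_succ', mul_assoc, expectCoeff_X_mul, ih]
    simp only [add_assoc]

theorem expectCoeff_X_sub_one_mul (h : ℕ → ℝ) (p : ℝ[X]) :
    expectCoeff h ((X - 1) * p) =
      ∑ x ∈ range (p.natDegree + 1), p.coeff x * (h (x + 1) - h x) := by
  rw [sub_mul, one_mul, map_sub, expectCoeff_X_mul, expectCoeff, expectCoeff,
    Polynomial.lsum_apply, Polynomial.lsum_apply, Polynomial.sum_over_range _ (by simp),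
    Polynomial.sum_over_range _ (by simp), ← Finset.sum_sub_distrib]
  refine Finset.sum_congr rfl fun x _ => ?_
  simp only [LinearMap.smul_apply, LinearMap.id_apply, smul_eq_mul]
  ring

theorem expectCoeff_threshold (p : ℝ[X]) (x : ℕ) :
    expectCoeff (fun m => if x + 1 ≤ m then 1 else 0) ((X - 1) * p) = p.coeff x := by
  rw [expectCoeff_X_sub_one_mul]
  have h : ∀ y, p.coeff y * ((if x + 1 ≤ y + 1 then (1 : ℝ) else 0) -
      if x + 1 ≤ y then 1 else 0) = if y = x then p.coeff y else 0 := by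
    intro y
    rcases lt_trichotomy y x with hy | rfl | hy
    · simp [hy.ne, not_le.2 hy, show ¬ x + 1 ≤ y by omega]
    · simp
    · simp [hy.ne', hy.le, Nat.succ_le_of_lt hy]
  simp only [h, Finset.sum_ite_eq', mem_range]
  split_ifs with hx
  · rfl
  · exact (coeff_eq_zero_of_natDegree_lt (by omega)).symm

/-- A polynomial with nonnegative coefficients that increase up to degree `M` and decrease
afterwards. -/
def IsUnimodal (p : ℝ[X]) (M : ℕ) : Prop :=
  (∀ x, 0 ≤ p.coeff x) ∧ (∀ x, x < M → p.coeff x ≤ p.coeff (x + 1)) ∧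
    ∀ x, M ≤ x → p.coeff (x + 1) ≤ p.coeff x

theorem isUnimodal_one : IsUnimodal 1 0 := by
  refine ⟨fun x => ?_, by simp, fun x _ => ?_⟩
  · rw [coeff_one]
    split_ifs <;> norm_num
  · rw [coeff_one, coeff_one, if_neg (Nat.succ_ne_zero x)]
    split_ifs <;> norm_num

theorem IsUnimodal.exists_linear_mul {p : ℝ[X]} {M : ℕ} (hp : IsUnimodal p M) {s q : ℝ}
    (hs : 0 ≤ s) (hq : 0 ≤ q) : ∃ M', IsUnimodal ((C s + C q * X) * p) M' := by
  obtain ⟨h0, hinc, hdec⟩ := hp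
  have c0 : ((C s + C q * X) * p).coeff 0 = s * p.coeff 0 := by
    simp [add_mul, mul_assoc]
  have cs : ∀ x, ((C s + C q * X) * p).coeff (x + 1) = s * p.coeff (x + 1) + q * p.coeff x := by
    intro x
    rw [add_mul, mul_assoc, coeff_add, coeff_C_mul, coeff_C_mul, coeff_X_mul]
  have hnn : ∀ x, 0 ≤ ((C s + C q * X) * p).coeff x := by
    rintro (_ | x)
    · rw [c0]
      exact mul_nonneg hs (h0 _)
    · rw [cs]
      exact add_nonneg (mul_nonneg hs (h0 _)) (mul_nonneg hq (h0 _))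
  have up : ∀ x, x < M →
      ((C s + C q * X) * p).coeff x ≤ ((C s + C q * X) * p).coeff (x + 1) := by
    rintro (_ | x) hx
    · rw [c0, cs]
      linarith [mul_le_mul_of_nonneg_left (hinc 0 hx) hs, mul_nonneg hq (h0 0)]
    · rw [cs, cs]
      exact add_le_add (mul_le_mul_of_nonneg_left (hinc _ hx) hs)
        (mul_le_mul_of_nonneg_left (hinc x (by omega)) hq)
  have down : ∀ x, M + 1 ≤ x →
      ((C s + C q * X) * p).coeff (x + 1) ≤ ((C s + C q * X) * p).coeff x := by
    rintro (_ | x) hx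
    · omega
    · rw [cs, cs]
      exact add_le_add (mul_le_mul_of_nonneg_left (hdec _ (by omega)) hs)
        (mul_le_mul_of_nonneg_left (hdec x (by omega)) hq)
  rcases le_total (((C s + C q * X) * p).coeff M) (((C s + C q * X) * p).coeff (M + 1)) with h | h
  · refine ⟨M + 1, hnn, fun x hx => ?_, down⟩
    rcases Nat.lt_succ_iff_lt_or_eq.1 hx with hx | rfl
    exacts [up x hx, h]
  · refine ⟨M, hnn, up, fun x hx => ?_⟩
    rcases hx.eq_or_lt with rfl | hx
    exacts [h, down x hx]

theorem IsUnimodal.expectCoeff_X_sub_one_mul_le {p : ℝ[X]} {M : ℕ} (hp : IsUnimodal p M)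
    {h : ℕ → ℝ} (hh : ∀ m, h m ∈ Set.Icc (0 : ℝ) 1) :
    expectCoeff h ((X - 1) * p) ≤ p.coeff M := by
  obtain ⟨h0, hinc, hdec⟩ := hp
  have rise : ∀ N ≤ M, ∑ x ∈ range N, p.coeff x * (h (x + 1) - h x) ≤ p.coeff N * h N := by
    intro N hN
    induction N with
    | zero => simpa using mul_nonneg (h0 0) (hh 0).1
    | succ N ih =>
      rw [Finset.sum_range_succ]
      linarith [ih (by omega), mul_le_mul_of_nonneg_right (hinc N hN) (hh (N + 1)).1]
  have fall : ∀ N, M ≤ N → ∑ x ∈ range N, p.coeff x * (h (x + 1) - h x) ≤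
      p.coeff M - p.coeff N * (1 - h N) := by
    intro N hN
    induction N, hN using Nat.le_induction with
    | base => linarith [rise M le_rfl]
    | succ N hN ih =>
      rw [Finset.sum_range_succ]
      linarith [mul_le_mul_of_nonneg_right (hdec N hN) (sub_nonneg.2 (hh (N + 1)).2)]
  rw [expectCoeff_X_sub_one_mul]
  rcases le_total M (p.natDegree + 1) with hM | hM
  · have := fall _ hM
    rw [coeff_eq_zero_of_natDegree_lt (Nat.lt_succ_self p.natDegree)] at this
    linarith
  · have := rise _ hM
    rw [coeff_eq_zero_of_natDegree_lt (Nat.lt_succ_self p.natDegree)] at this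
    linarith [h0 M]

theorem IsUnimodal.abs_expectCoeff_X_sub_one_mul_le {p : ℝ[X]} {M : ℕ} (hp : IsUnimodal p M)
    {h : ℕ → ℝ} (hh : ∀ m, h m ∈ Set.Icc (0 : ℝ) 1) :
    |expectCoeff h ((X - 1) * p)| ≤ p.coeff M := by
  refine abs_le.2 ⟨?_, hp.expectCoeff_X_sub_one_mul_le hh⟩
  have h1 := hp.expectCoeff_X_sub_one_mul_le (h := fun m => 1 - h m)
    fun m => ⟨sub_nonneg.2 (hh m).2, sub_le_self _ (hh m).1⟩
  have h2 : expectCoeff (fun m => 1 - h m) ((X - 1) * p) = -expectCoeff h ((X - 1) * p) := by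
    rw [expectCoeff_X_sub_one_mul, expectCoeff_X_sub_one_mul, ← Finset.sum_neg_distrib]
    exact Finset.sum_congr rfl fun x _ => by ring
  linarith

theorem sum_prod_mul_eq_expectCoeff {n k : ℕ} (w : Fin n → Fin k → ℝ) (h : ℕ → ℝ) :
    ∑ b : Fin n → Fin k, (∏ i, w i (b i)) * h (∑ i, (b i : ℕ)) =
      expectCoeff h (∏ i, ∑ c : Fin k, C (w i c) * X ^ (c : ℕ)) := by
  rw [Finset.prod_univ_sum, Fintype.piFinset_univ, map_sum]
  refine Finset.sum_congr rfl fun b _ => ?_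
  rw [Finset.prod_mul_distrib, Finset.prod_pow_eq_pow_sum, ← map_prod, C_mul_X_pow_eq_monomial,
    expectCoeff_monomial, mul_comm]

end GeneratingPolynomials

section Fourier

open Polynomial

theorem integral_exp_int_mul_I (z : ℤ) :
    ∫ t in -Real.pi..Real.pi, Complex.exp (z * t * Complex.I) =
      if z = 0 then (2 * Real.pi : ℂ) else 0 := by
  split_ifs with hz
  · subst hz
    simp
    ring
  · have hc : (z * Complex.I : ℂ) ≠ 0 := by simp [hz]
    have h := integral_exp_mul_complex (a := -Real.pi) (b := Real.pi) hc
    have e : ∀ t : ℝ, (z * t * Complex.I : ℂ) = z * Complex.I * t := fun t => by ring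
    simp only [e]
    rw [h, div_eq_zero_iff]
    left
    rw [sub_eq_zero, Complex.exp_eq_exp_iff_exists_int]
    refine ⟨z, ?_⟩
    push_cast
    ring

theorem integral_aeval_exp_mul_exp (p : ℝ[X]) (x : ℕ) :
    ∫ t in -Real.pi..Real.pi,
      aeval (Complex.exp (t * Complex.I)) p * Complex.exp (-(x * t * Complex.I)) =
      2 * Real.pi * (p.coeff x : ℂ) := by
  have e : ∀ t : ℝ,
      aeval (Complex.exp (t * Complex.I)) p * Complex.exp (-(x * t * Complex.I)) =
      ∑ m ∈ range (p.natDegree + 1),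
        (p.coeff m : ℂ) * Complex.exp (((m - x : ℤ) : ℂ) * t * Complex.I) := by
    intro t
    rw [aeval_eq_sum_range, Finset.sum_mul]
    refine Finset.sum_congr rfl fun m _ => ?_
    rw [← Complex.exp_nat_mul, Complex.real_smul, mul_assoc, ← Complex.exp_add]
    congr 2
    push_cast
    ring
  simp only [e]
  rw [intervalIntegral.integral_finsetSum
    fun m _ => Continuous.intervalIntegrable (by fun_prop) _ _]
  simp only [intervalIntegral.integral_const_mul, integral_exp_int_mul_I, sub_eq_zero,
    Nat.cast_inj, mul_ite, mul_zero, Finset.sum_ite_eq', mem_range]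
  split_ifs with hx
  · ring
  · rw [coeff_eq_zero_of_natDegree_lt (by omega)]
    simp

end Fourier

section PerturbedAction

open Polynomial

/-- The generating polynomial of the `δ`-perturbation of the pure action `x`. -/
noncomputable def bern (δ : ℝ) (x : Fin 2) : ℝ[X] :=
  C (perturbW 2 δ x 0) + C (perturbW 2 δ x 1) * X

theorem perturbW_two_nonneg {δ : ℝ} (hδ : δ ∈ Set.Ioo (0 : ℝ) 1) (x c : Fin 2) :
    0 ≤ perturbW 2 δ x c := by
  have h1 := hδ.1
  have h2 := hδ.2
  unfold perturbW
  push_cast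
  split_ifs <;> linarith

theorem sum_perturbW_two (δ : ℝ) (x : Fin 2) : ∑ c, perturbW 2 δ x c = 1 := by
  fin_cases x <;> simp [perturbW] <;> ring

theorem sum_C_perturbW_mul_X_pow (δ : ℝ) (x : Fin 2) :
    ∑ c : Fin 2, C (perturbW 2 δ x c) * X ^ (c : ℕ) = bern δ x := by
  simp [Fin.sum_univ_two, bern]

theorem bern_sub_bern (δ : ℝ) (x y : Fin 2) :
    bern δ x - bern δ y = C ((1 - δ) * ((x : ℝ) - (y : ℝ))) * (X - 1) := by
  fin_cases x <;> fin_cases y <;> simp [bern, perturbW] <;> ring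

theorem exists_isUnimodal_prod_bern {ι : Type*} {δ : ℝ} (hδ : δ ∈ Set.Ioo (0 : ℝ) 1)
    (S : Finset ι) (a : ι → Fin 2) : ∃ M, IsUnimodal (∏ k ∈ S, bern δ (a k)) M := by
  classical
  induction S using Finset.induction_on with
  | empty => exact ⟨0, by simpa using isUnimodal_one⟩
  | insert k S hk ih =>
    obtain ⟨M, hM⟩ := ih
    rw [Finset.prod_insert hk]
    exact hM.exists_linear_mul (perturbW_two_nonneg hδ _ _) (perturbW_two_nonneg hδ _ _)

theorem norm_aeval_exp_bern (δ t : ℝ) (x : Fin 2) :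
    ‖aeval (Complex.exp (t * Complex.I)) (bern δ x)‖ =
      √(1 - δ * (1 - δ / 2) * (1 - Real.cos t)) := by
  have key : ∀ s q : ℝ, ‖(s : ℂ) + q * Complex.exp (t * Complex.I)‖ =
      √(s ^ 2 + q ^ 2 + 2 * s * q * Real.cos t) := by
    intro s q
    rw [Complex.norm_def, Complex.normSq_apply, Complex.exp_mul_I, ← Complex.ofReal_cos,
      ← Complex.ofReal_sin]
    congr 1
    simp [-Complex.ofReal_cos, -Complex.ofReal_sin]
    linear_combination q ^ 2 * Real.sin_sq_add_cos_sq t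
  simp only [bern, map_add, map_mul, aeval_C, aeval_X, Complex.coe_algebraMap]
  rw [key]
  congr 1
  fin_cases x <;> simp [perturbW] <;> ring

theorem coeff_prod_bern_le {ι : Type*} (δ : ℝ) (S : Finset ι) (a : ι → Fin 2) (x : ℕ) :
    (∏ k ∈ S, bern δ (a k)).coeff x ≤ charAverage #S (δ * (1 - δ / 2)) := by
  have hpi := Real.pi_pos
  have h := integral_aeval_exp_mul_exp (∏ k ∈ S, bern δ (a k)) x
  have hn := intervalIntegral.norm_integral_le_integral_norm (μ := MeasureTheory.volume)
    (f := fun t : ℝ => aeval (Complex.exp (t * Complex.I)) (∏ k ∈ S, bern δ (a k)) *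
      Complex.exp (-(x * t * Complex.I))) (neg_le_self hpi.le)
  have e : ∀ t : ℝ, ‖aeval (Complex.exp (t * Complex.I)) (∏ k ∈ S, bern δ (a k)) *
      Complex.exp (-(x * t * Complex.I))‖ = √(1 - δ * (1 - δ / 2) * (1 - Real.cos t)) ^ #S := by
    intro t
    have e1 : (-(x * t * Complex.I) : ℂ) = ((-(x * t) : ℝ) : ℂ) * Complex.I := by
      push_cast
      ring
    rw [norm_mul, e1, Complex.norm_exp_ofReal_mul_I, mul_one, map_prod, norm_prod]
    simp only [norm_aeval_exp_bern, Finset.prod_const]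
  simp only [e] at hn
  rw [h] at hn
  have hn' : ‖(2 * Real.pi * ((∏ k ∈ S, bern δ (a k)).coeff x : ℝ) : ℂ)‖ =
      2 * Real.pi * |(∏ k ∈ S, bern δ (a k)).coeff x| := by
    simp [abs_of_pos hpi]
  rw [hn'] at hn
  rw [charAverage, ← div_eq_inv_mul, le_div_iff₀ (by positivity)]
  nlinarith [le_abs_self ((∏ k ∈ S, bern δ (a k)).coeff x)]

theorem coeff_bern_mul_bern_pow {δ : ℝ} (hδ : δ ∈ Set.Ioo (0 : ℝ) 1) (m : ℕ) :
    ((bern δ 0 * bern δ 1) ^ m).coeff m = charAverage (2 * m) (δ * (1 - δ / 2)) := by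
  have hpi := Real.pi_pos
  have h := integral_aeval_exp_mul_exp ((bern δ 0 * bern δ 1) ^ m) m
  have e : ∀ t : ℝ, aeval (Complex.exp (t * Complex.I)) ((bern δ 0 * bern δ 1) ^ m) *
      Complex.exp (-(m * t * Complex.I)) =
      ((√(1 - δ * (1 - δ / 2) * (1 - Real.cos t)) ^ (2 * m) : ℝ) : ℂ) := by
    intro t
    have hnn : 0 ≤ 1 - δ * (1 - δ / 2) * (1 - Real.cos t) := by
      have h1 : 0 < δ * (1 - δ / 2) := mul_pos hδ.1 (by linarith [hδ.2])
      have h2 : δ * (1 - δ / 2) ≤ 1 / 2 := by nlinarith [sq_nonneg (1 - δ)]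
      nlinarith [Real.neg_one_le_cos t]
    have e1 : (-(m * t * Complex.I) : ℂ) = m * (-(t * Complex.I)) := by ring
    rw [pow_mul, Real.sq_sqrt hnn, e1, Complex.exp_nat_mul, map_pow, ← mul_pow]
    push_cast
    congr 1
    have e2 : Complex.exp (t * Complex.I) * Complex.exp (-(t * Complex.I)) = 1 := by
      rw [← Complex.exp_add]
      simp
    have e3 : Complex.cos t =
        (Complex.exp (t * Complex.I) + Complex.exp (-(t * Complex.I))) / 2 := by
      rw [Complex.cos, neg_mul]
    rw [e3]
    simp only [bern, map_add, map_mul, aeval_C, aeval_X, Complex.coe_algebraMap]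
    simp [perturbW]
    generalize Complex.exp (t * Complex.I) = z at *
    generalize Complex.exp (-(t * Complex.I)) = w at *
    linear_combination ((1 - δ / 2) ^ 2 + (δ / 2) ^ 2 + (1 - δ / 2) * (δ / 2) * z) * e2
  simp only [e] at h
  rw [intervalIntegral.integral_ofReal] at h
  have h' : ∫ t in -Real.pi..Real.pi, √(1 - δ * (1 - δ / 2) * (1 - Real.cos t)) ^ (2 * m) =
      2 * Real.pi * ((bern δ 0 * bern δ 1) ^ m).coeff m := by
    exact_mod_cast h
  rw [charAverage, h']
  field_simp

theorem coeff_bern_mul_le {δ K : ℝ} (hδ : δ ∈ Set.Ioo (0 : ℝ) 1) (hK : 0 ≤ K) {p : ℝ[X]}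
    (hp : ∀ x, p.coeff x ≤ K) (y : Fin 2) (x : ℕ) : (bern δ y * p).coeff x ≤ K := by
  have h0 := perturbW_two_nonneg hδ y 0
  have h1 := perturbW_two_nonneg hδ y 1
  have hs := sum_perturbW_two δ y
  rw [Fin.sum_univ_two] at hs
  rcases x with _ | x
  · have : (bern δ y * p).coeff 0 = perturbW 2 δ y 0 * p.coeff 0 := by
      simp [bern, add_mul, mul_assoc]
    rw [this]
    nlinarith [mul_le_mul_of_nonneg_left (hp 0) h0, mul_nonneg h1 hK]
  · rw [bern, add_mul, mul_assoc, coeff_add, coeff_C_mul, coeff_C_mul, coeff_X_mul]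
    nlinarith [mul_le_mul_of_nonneg_left (hp (x + 1)) h0, mul_le_mul_of_nonneg_left (hp x) h1]

end PerturbedAction

section Games

open Polynomial

variable {n : ℕ} {δ : ℝ}

theorem actCount_one (a : Fin n → Fin 2) : actCount n 2 a 1 = ∑ k, (a k : ℕ) := by
  rw [actCount, Finset.card_filter]
  refine Finset.sum_congr rfl fun k _ => ?_
  generalize a k = x
  fin_cases x <;> simp

theorem actCount_zero_add_actCount_one (a : Fin n → Fin 2) :
    actCount n 2 a 0 + actCount n 2 a 1 = n := by
  rw [actCount, actCount, Finset.card_filter, Finset.card_filter, ← Finset.sum_add_distrib]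
  have h : ∀ k, ((if a k = 0 then 1 else 0) + if a k = 1 then 1 else 0) = 1 := by
    intro k
    generalize a k = x
    fin_cases x <;> simp
  simp [h]

theorem IsAnonymous.eq_of_sum_eq {g : (Fin n → Fin 2) → Fin n → ℝ} (hg : IsAnonymous n 2 g)
    {a b : Fin n → Fin 2} {i : Fin n} (hi : a i = b i)
    (hs : ∑ k, (a k : ℕ) = ∑ k, (b k : ℕ)) : g a i = g b i := by
  refine hg a b i hi fun j => ?_
  have h1 : actCount n 2 a 1 = actCount n 2 b 1 := by rw [actCount_one, actCount_one, hs]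
  have ha := actCount_zero_add_actCount_one a
  have hb := actCount_zero_add_actCount_one b
  fin_cases j
  · change actCount n 2 a 0 = actCount n 2 b 0
    omega
  · exact h1

theorem IsAnonymous.exists_payoff {g : (Fin n → Fin 2) → Fin n → ℝ} (hg : IsAnonymous n 2 g)
    (hgame : IsGame n 2 g) (i : Fin n) :
    ∃ G : Fin 2 → ℕ → ℝ, (∀ c m, G c m ∈ Set.Icc (0 : ℝ) 1) ∧
      ∀ b, g b i = G (b i) (∑ k, (b k : ℕ)) := by
  classical
  refine ⟨fun c m => if h : ∃ b : Fin n → Fin 2, b i = c ∧ ∑ k, (b k : ℕ) = m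
    then g h.choose i else 0, fun c m => ?_, fun b => ?_⟩
  · dsimp only
    split_ifs with h
    · exact hgame _ _
    · simp
  · have h : ∃ b' : Fin n → Fin 2, b' i = b i ∧ ∑ k, (b' k : ℕ) = ∑ k, (b k : ℕ) :=
      ⟨b, rfl, rfl⟩
    simp only [dif_pos h]
    exact hg.eq_of_sum_eq h.choose_spec.1.symm h.choose_spec.2.symm

theorem perturbGame_eq_sum_expectCoeff {g : (Fin n → Fin 2) → Fin n → ℝ} {i : Fin n}
    {G : Fin 2 → ℕ → ℝ} (hG : ∀ b, g b i = G (b i) (∑ k, (b k : ℕ))) (a : Fin n → Fin 2) :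
    perturbGame n 2 δ g a i = ∑ c, perturbW 2 δ (a i) c *
      expectCoeff (fun m => G c (m + c)) (∏ k ∈ univ.erase i, bern δ (a k)) := by
  set w : Fin 2 → Fin n → Fin 2 → ℝ := fun c k c' =>
    if k = i then (if c' = c then perturbW 2 δ (a i) c else 0) else perturbW 2 δ (a k) c' with hw
  have herase : ∀ k ∈ univ.erase i, k ≠ i := fun k hk => Finset.ne_of_mem_erase hk
  have hprod : ∀ c (b : Fin n → Fin 2),
      ∏ k, w c k (b k) = if b i = c then profW n 2 δ a b else 0 := by
    intro c b
    rw [profW, ← Finset.mul_prod_erase univ _ (mem_univ i),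
      ← Finset.mul_prod_erase univ (fun k => perturbW 2 δ (a k) (b k)) (mem_univ i),
      Finset.prod_congr rfl fun k hk => show w c k (b k) = perturbW 2 δ (a k) (b k) by
        simp [hw, herase k hk]]
    by_cases h : b i = c <;> simp [hw, h]
  have hpoly : ∀ c, (∏ k, ∑ c' : Fin 2, C (w c k c') * X ^ (c' : ℕ)) =
      perturbW 2 δ (a i) c • (X ^ (c : ℕ) * ∏ k ∈ univ.erase i, bern δ (a k)) := by
    intro c
    rw [← Finset.mul_prod_erase univ _ (mem_univ i), smul_eq_C_mul, ← mul_assoc]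
    congr 1
    · rw [Finset.sum_eq_single c]
      · simp [hw]
      · intro c' _ hc
        simp [hw, hc]
      · simp
    · refine Finset.prod_congr rfl fun k hk => ?_
      simp only [hw, if_neg (herase k hk), sum_C_perturbW_mul_X_pow]
  calc perturbGame n 2 δ g a i
      = ∑ b : Fin n → Fin 2, ∑ c, (∏ k, w c k (b k)) * G c (∑ k, (b k : ℕ)) := by
        refine Finset.sum_congr rfl fun b _ => ?_
        simp only [hprod, ite_mul, zero_mul, Finset.sum_ite_eq, mem_univ, if_true, hG]
    _ = ∑ c, ∑ b : Fin n → Fin 2, (∏ k, w c k (b k)) * G c (∑ k, (b k : ℕ)) :=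
        Finset.sum_comm
    _ = _ := by
        refine Finset.sum_congr rfl fun c _ => ?_
        rw [sum_prod_mul_eq_expectCoeff, hpoly, map_smul, expectCoeff_X_pow_mul, smul_eq_mul]

theorem perturbGame_sub_perturbGame {g : (Fin n → Fin 2) → Fin n → ℝ} {i j : Fin n}
    {G : Fin 2 → ℕ → ℝ} (hG : ∀ b, g b i = G (b i) (∑ k, (b k : ℕ))) (hji : j ≠ i)
    {a b : Fin n → Fin 2} (hab : ∀ k, k ≠ j → a k = b k) :
    perturbGame n 2 δ g a i - perturbGame n 2 δ g b i =
      (1 - δ) * ((a j : ℝ) - (b j : ℝ)) * ∑ c, perturbW 2 δ (a i) c *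
        expectCoeff (fun m => G c (m + c))
          ((X - 1) * ∏ k ∈ (univ.erase i).erase j, bern δ (a k)) := by
  have hj : j ∈ univ.erase i := by simp [hji]
  rw [perturbGame_eq_sum_expectCoeff hG, perturbGame_eq_sum_expectCoeff hG,
    ← Finset.sum_sub_distrib, Finset.mul_sum]
  refine Finset.sum_congr rfl fun c _ => ?_
  have hrest : ∏ k ∈ (univ.erase i).erase j, bern δ (b k) =
      ∏ k ∈ (univ.erase i).erase j, bern δ (a k) :=
    Finset.prod_congr rfl fun k hk => by rw [hab k (Finset.ne_of_mem_erase hk)]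
  rw [← Finset.mul_prod_erase _ (fun k => bern δ (a k)) hj,
    ← Finset.mul_prod_erase _ (fun k => bern δ (b k)) hj, hrest, hab i hji.symm, ← mul_sub,
    ← map_sub, ← sub_mul, bern_sub_bern, mul_assoc, ← smul_eq_C_mul, map_smul, smul_eq_mul]
  ring

theorem abs_perturbGame_sub_le (hδ : δ ∈ Set.Ioo (0 : ℝ) 1)
    {g : (Fin n → Fin 2) → Fin n → ℝ} (hgame : IsGame n 2 g) (hg : IsAnonymous n 2 g)
    {i : Fin n} {a b : Fin n → Fin 2} (hi : a i = b i)
    (hcard : (Finset.univ.filter fun j => a j ≠ b j).card = 1) :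
    |perturbGame n 2 δ g a i - perturbGame n 2 δ g b i| ≤
      (1 - δ) * charAverage (n - 2) (δ * (1 - δ / 2)) := by
  obtain ⟨G, hG01, hG⟩ := hg.exists_payoff hgame i
  obtain ⟨j, hj⟩ := Finset.card_eq_one.1 hcard
  have hmem : ∀ k, a k ≠ b k ↔ k = j := fun k => by
    simpa using Finset.ext_iff.1 hj k
  have hab : ∀ k, k ≠ j → a k = b k := fun k hk => not_not.1 fun h => hk ((hmem k).1 h)
  have hji : j ≠ i := by
    rintro rfl
    exact (hmem j).2 rfl hi
  have hcardS : #((univ.erase i).erase j) = n - 2 := by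
    rw [Finset.card_erase_of_mem (by simp [hji]), Finset.card_erase_of_mem (mem_univ i),
      Finset.card_univ, Fintype.card_fin]
    omega
  obtain ⟨M, hM⟩ := exists_isUnimodal_prod_bern hδ ((univ.erase i).erase j) a
  have hcoeff := coeff_prod_bern_le δ ((univ.erase i).erase j) a M
  rw [hcardS] at hcoeff
  rw [perturbGame_sub_perturbGame hG hji hab, abs_mul, abs_mul,
    abs_of_pos (sub_pos.2 hδ.2)]
  have hone : |(a j : ℝ) - (b j : ℝ)| ≤ 1 := by
    generalize a j = x
    generalize b j = y
    fin_cases x <;> fin_cases y <;> simp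
  have hsum : |∑ c, perturbW 2 δ (a i) c * expectCoeff (fun m => G c (m + c))
      ((X - 1) * ∏ k ∈ (univ.erase i).erase j, bern δ (a k))| ≤
      charAverage (n - 2) (δ * (1 - δ / 2)) := by
    calc _ ≤ ∑ c, |perturbW 2 δ (a i) c * expectCoeff (fun m => G c (m + c))
          ((X - 1) * ∏ k ∈ (univ.erase i).erase j, bern δ (a k))| :=
          Finset.abs_sum_le_sum_abs _ _
      _ ≤ ∑ c, perturbW 2 δ (a i) c * charAverage (n - 2) (δ * (1 - δ / 2)) := by
          refine Finset.sum_le_sum fun c _ => ?_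
          rw [abs_mul, abs_of_nonneg (perturbW_two_nonneg hδ _ _)]
          exact mul_le_mul_of_nonneg_left
            ((hM.abs_expectCoeff_X_sub_one_mul_le fun m => hG01 _ _).trans hcoeff)
            (perturbW_two_nonneg hδ _ _)
      _ = _ := by rw [← Finset.sum_mul, sum_perturbW_two, one_mul]
  have h1 : 0 ≤ 1 - δ := by linarith [hδ.2]
  calc _ ≤ (1 - δ) * 1 * charAverage (n - 2) (δ * (1 - δ / 2)) := by
        gcongr
    _ = _ := by rw [mul_one]

theorem mul_charAverage_nonneg (hδ : δ ∈ Set.Ioo (0 : ℝ) 1) (N : ℕ) (r : ℝ) :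
    0 ≤ (1 - δ) * charAverage N r :=
  mul_nonneg (sub_nonneg.2 hδ.2.le) (charAverage_nonneg _ _)

theorem lipC_perturbGame_le (hδ : δ ∈ Set.Ioo (0 : ℝ) 1)
    {g : (Fin n → Fin 2) → Fin n → ℝ} (hgame : IsGame n 2 g) (hg : IsAnonymous n 2 g) :
    lipC n 2 (perturbGame n 2 δ g) ≤ (1 - δ) * charAverage (n - 2) (δ * (1 - δ / 2)) := by
  refine Real.sSup_le ?_ (mul_charAverage_nonneg hδ _ _)
  rintro _ ⟨i, a, b, hi, hcard, rfl⟩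
  exact abs_perturbGame_sub_le hδ hgame hg hi hcard

theorem lam_two_le (hδ : δ ∈ Set.Ioo (0 : ℝ) 1) :
    lam n 2 δ ≤ (1 - δ) * charAverage (n - 2) (δ * (1 - δ / 2)) := by
  refine Real.sSup_le ?_ (mul_charAverage_nonneg hδ _ _)
  rintro _ ⟨g, hgame, hg, rfl⟩
  exact lipC_perturbGame_le hδ hgame hg

theorem abs_perturbGame_sub_le_lam (hδ : δ ∈ Set.Ioo (0 : ℝ) 1)
    {g : (Fin n → Fin 2) → Fin n → ℝ} (hgame : IsGame n 2 g) (hg : IsAnonymous n 2 g)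
    {i : Fin n} {a b : Fin n → Fin 2} (hi : a i = b i)
    (hcard : (Finset.univ.filter fun j => a j ≠ b j).card = 1) :
    |perturbGame n 2 δ g a i - perturbGame n 2 δ g b i| ≤ lam n 2 δ := by
  have hlip : |perturbGame n 2 δ g a i - perturbGame n 2 δ g b i| ≤
      lipC n 2 (perturbGame n 2 δ g) := by
    refine le_csSup ⟨(1 - δ) * charAverage (n - 2) (δ * (1 - δ / 2)), ?_⟩
      ⟨i, a, b, hi, hcard, rfl⟩
    rintro _ ⟨i, a, b, hi, hcard, rfl⟩
    exact abs_perturbGame_sub_le hδ hgame hg hi hcard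
  refine hlip.trans (le_csSup ⟨(1 - δ) * charAverage (n - 2) (δ * (1 - δ / 2)), ?_⟩
    ⟨g, hgame, hg, rfl⟩)
  rintro _ ⟨g, hgame, hg, rfl⟩
  exact lipC_perturbGame_le hδ hgame hg

theorem mul_coeff_prod_bern_le_lam (hδ : δ ∈ Set.Ioo (0 : ℝ) 1) {i j : Fin n} (hji : j ≠ i)
    (a : Fin n → Fin 2) (x : ℕ) :
    (1 - δ) * (∏ k ∈ (univ.erase i).erase j, bern δ (a k)).coeff x ≤ lam n 2 δ := by
  set G : Fin 2 → ℕ → ℝ := fun c m => if x + 1 + c ≤ m then 1 else 0 with hGdef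
  set g : (Fin n → Fin 2) → Fin n → ℝ := fun b i => G (b i) (∑ k, (b k : ℕ)) with hgdef
  have hgame : IsGame n 2 g := by
    intro b i
    simp only [hgdef, hGdef]
    split_ifs <;> simp
  have hg : IsAnonymous n 2 g := by
    intro b b' i hi hcount
    simp only [hgdef, ← actCount_one, hi, hcount]
  set a₁ := Function.update a j 1
  set a₀ := Function.update a j 0
  have hne : ∀ k, a₁ k ≠ a₀ k ↔ k = j := by
    intro k
    rcases eq_or_ne k j with rfl | hk
    · simp [a₁, a₀]
    · simp [a₁, a₀, hk]
  have hi : a₁ i = a₀ i := not_not.1 fun h => hji ((hne i).1 h).symm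
  have hcard : (Finset.univ.filter fun k => a₁ k ≠ a₀ k).card = 1 := by
    refine Finset.card_eq_one.2 ⟨j, ?_⟩
    ext k
    rw [Finset.mem_filter, Finset.mem_singleton, hne k]
    simp
  have hle := abs_perturbGame_sub_le_lam hδ hgame hg hi hcard
  have hrest : ∏ k ∈ (univ.erase i).erase j, bern δ (a₁ k) =
      ∏ k ∈ (univ.erase i).erase j, bern δ (a k) :=
    Finset.prod_congr rfl fun k hk => by simp [a₁, Finset.ne_of_mem_erase hk]
  rw [perturbGame_sub_perturbGame (G := G) (fun _ => rfl) hji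
    fun k hk => not_not.1 fun h => hk ((hne k).1 h), hrest] at hle
  have hshift : ∀ c : Fin 2, (fun m => G c (m + c)) = fun m => if x + 1 ≤ m then 1 else 0 := by
    intro c
    funext m
    simp only [hGdef, Nat.add_le_add_iff_right]
  have hj : ((a₁ j : ℝ) - (a₀ j : ℝ)) = 1 := by simp [a₁, a₀]
  simp only [hshift, expectCoeff_threshold] at hle
  rw [← Finset.sum_mul, sum_perturbW_two, hj, mul_one, one_mul] at hle
  exact (le_abs_self _).trans hle

theorem mul_charAverage_le_lam_two (hn : 2 ≤ n) (hδ : δ ∈ Set.Ioo (0 : ℝ) 1) :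
    (1 - δ) * charAverage n (δ * (1 - δ / 2)) ≤ lam n 2 δ := by
  have hδ' : 0 < 1 - δ := sub_pos.2 hδ.2
  let i : Fin n := ⟨0, by omega⟩
  let j : Fin n := ⟨1, by omega⟩
  have hji : j ≠ i := by simp [i, j]
  have hcardS : #((univ.erase i).erase j) = n - 2 := by
    rw [Finset.card_erase_of_mem (by simp [hji]), Finset.card_erase_of_mem (mem_univ i),
      Finset.card_univ, Fintype.card_fin]
    omega
  obtain ⟨T, hTS, hT⟩ := Finset.exists_subset_card_eq
    (show (n - 2) / 2 ≤ #((univ.erase i).erase j) by omega)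
  let a : Fin n → Fin 2 := fun k => if k ∈ T then 1 else 0
  have hprod : ∏ k ∈ (univ.erase i).erase j, bern δ (a k) =
      bern δ 0 ^ (n - 2 - (n - 2) / 2) * bern δ 1 ^ ((n - 2) / 2) := by
    rw [← Finset.prod_sdiff hTS, Finset.prod_congr rfl fun k hk => show bern δ (a k) = bern δ 0 by
        simp [a, (Finset.mem_sdiff.1 hk).2],
      Finset.prod_congr (s₁ := T) rfl fun k hk => show bern δ (a k) = bern δ 1 by simp [a, hk],
      Finset.prod_const, Finset.prod_const, Finset.card_sdiff_of_subset hTS, hT, hcardS]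
  have hP : ∀ x, (bern δ 0 ^ (n - 2 - (n - 2) / 2) * bern δ 1 ^ ((n - 2) / 2)).coeff x ≤
      lam n 2 δ / (1 - δ) := by
    intro x
    rw [le_div_iff₀' hδ', ← hprod]
    exact mul_coeff_prod_bern_le_lam hδ hji a x
  have hlam : 0 ≤ lam n 2 δ / (1 - δ) := by
    obtain ⟨M, hM⟩ := exists_isUnimodal_prod_bern hδ ((univ.erase i).erase j) a
    rw [hprod] at hM
    exact (hM.1 0).trans (hP 0)
  set m := n - 2 - (n - 2) / 2
  have hbal : ((bern δ 0 * bern δ 1) ^ m).coeff m ≤ lam n 2 δ / (1 - δ) := by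
    rcases (show m = (n - 2) / 2 ∨ m = (n - 2) / 2 + 1 by omega) with h | h
    · rw [mul_pow]
      nth_rw 2 [h]
      exact hP m
    · have e : (bern δ 0 * bern δ 1) ^ m =
          bern δ 1 * (bern δ 0 ^ m * bern δ 1 ^ ((n - 2) / 2)) := by
        rw [mul_pow]
        nth_rw 2 [h]
        ring
      rw [e]
      exact coeff_bern_mul_le hδ hlam hP 1 m
  rw [coeff_bern_mul_bern_pow hδ, le_div_iff₀' hδ'] at hbal
  refine le_trans ?_ hbal
  refine mul_le_mul_of_nonneg_left ?_ hδ'.le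
  exact charAverage_antitone (mul_nonneg hδ.1.le (by linarith [hδ.2])) (by omega)

end Games

section LargeGames

open Filter Topology

/-- The filter on pairs `(n, δ)` with `n ≥ 2` and `δ ∈ (0, 1)` along which `n δ → ∞`. -/
def largeGames : Filter (ℕ × ℝ) :=
  comap (fun p : ℕ × ℝ => (p.1 : ℝ) * p.2) atTop ⊓ 𝓟 {p | 2 ≤ p.1 ∧ p.2 ∈ Set.Ioo (0 : ℝ) 1}

instance : largeGames.IsCountablyGenerated := by
  unfold largeGames
  infer_instance

theorem tendsto_largeGames : Tendsto (fun p : ℕ × ℝ => (p.1 : ℝ) * p.2) largeGames atTop :=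
  tendsto_comap.mono_left inf_le_left

theorem eventually_largeGames :
    ∀ᶠ p : ℕ × ℝ in largeGames, 2 ≤ p.1 ∧ p.2 ∈ Set.Ioo (0 : ℝ) 1 :=
  mem_inf_of_right (mem_principal_self _)

theorem eventually_largeGames_rate :
    ∀ᶠ p : ℕ × ℝ in largeGames, 0 < p.2 * (1 - p.2 / 2) ∧ p.2 * (1 - p.2 / 2) ≤ 1 / 2 := by
  filter_upwards [eventually_largeGames] with p hp
  have h1 := hp.2.1
  have h2 := hp.2.2
  exact ⟨mul_pos h1 (by linarith), by nlinarith [sq_nonneg (1 - p.2)]⟩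

theorem tendsto_lower_largeGames :
    Tendsto (fun p : ℕ × ℝ => √(Real.pi * (p.1 * (p.2 * (1 - p.2 / 2)))) *
      charAverage p.1 (p.2 * (1 - p.2 / 2))) largeGames (𝓝 1) := by
  refine tendsto_sqrt_mul_charAverage eventually_largeGames_rate ?_
  refine tendsto_atTop_mono' _ ?_ (tendsto_largeGames.atTop_div_const two_pos)
  filter_upwards [eventually_largeGames] with p hp
  have h : 0 ≤ (p.1 : ℝ) * p.2 := mul_nonneg (by positivity) hp.2.1.le
  nlinarith [hp.2.2]

theorem tendsto_upper_largeGames :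
    Tendsto (fun p : ℕ × ℝ => √(Real.pi * (p.1 * (p.2 * (1 - p.2 / 2)))) *
      charAverage (p.1 - 2) (p.2 * (1 - p.2 / 2))) largeGames (𝓝 1) := by
  have hN : Tendsto (fun p : ℕ × ℝ => (p.1 : ℝ)) largeGames atTop := by
    refine tendsto_atTop_mono' _ ?_ tendsto_largeGames
    filter_upwards [eventually_largeGames] with p hp
    exact mul_le_of_le_one_right (by positivity) hp.2.2.le
  have hsub : Tendsto (fun p : ℕ × ℝ => (p.1 : ℝ) - 2) largeGames atTop :=
    tendsto_atTop_add_const_right _ _ hN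
  have hratio : Tendsto (fun p : ℕ × ℝ => √(1 + 2 / ((p.1 : ℝ) - 2))) largeGames (𝓝 1) := by
    simpa using ((hsub.const_div_atTop 2).const_add 1).sqrt
  have hmain : Tendsto (fun p : ℕ × ℝ =>
      √(Real.pi * ((p.1 - 2 : ℕ) * (p.2 * (1 - p.2 / 2)))) *
        charAverage (p.1 - 2) (p.2 * (1 - p.2 / 2))) largeGames (𝓝 1) := by
    refine tendsto_sqrt_mul_charAverage eventually_largeGames_rate ?_
    refine tendsto_atTop_mono' _ ?_
      (tendsto_atTop_add_const_right _ (-1) (tendsto_largeGames.atTop_div_const two_pos))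
    filter_upwards [eventually_largeGames] with p hp
    have h : 0 ≤ (p.1 : ℝ) * p.2 := mul_nonneg (by positivity) hp.2.1.le
    rw [Nat.cast_sub hp.1]
    push_cast
    nlinarith [hp.2.2]
  have hmul := hratio.mul hmain
  rw [one_mul] at hmul
  refine hmul.congr' ?_
  filter_upwards [eventually_largeGames, hsub.eventually_gt_atTop 0] with p hp hpos
  rw [← mul_assoc, ← Real.sqrt_mul (by positivity), Nat.cast_sub hp.1]
  congr 2
  push_cast
  field_simp
  ring

end LargeGames

/-- As `nδ → ∞`, `(1-δ)⁻¹·√(πnδ(1-δ/2))·λ(n,2,δ) → 1`. -/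
theorem lipschitz_constant_asymptotics_two_actions (ε : ℝ) (hε : 0 < ε) :
    ∃ M : ℝ, ∀ (n : ℕ) (δ : ℝ), 2 ≤ n → δ ∈ Set.Ioo (0 : ℝ) 1 →
      M ≤ (n : ℝ) * δ →
      |(1 - δ)⁻¹ * Real.sqrt (Real.pi * n * δ * (1 - δ / 2)) * lam n 2 δ - 1| < ε := by
  have hlow := tendsto_lower_largeGames.eventually_const_lt (sub_lt_self 1 hε)
  have hupp := tendsto_upper_largeGames.eventually_lt_const (lt_add_of_pos_right 1 hε)
  obtain ⟨M, hM⟩ : ∃ M : ℝ, ∀ p : ℕ × ℝ, M ≤ (p.1 : ℝ) * p.2 →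
      2 ≤ p.1 ∧ p.2 ∈ Set.Ioo (0 : ℝ) 1 →
      1 - ε < √(Real.pi * (p.1 * (p.2 * (1 - p.2 / 2)))) *
        charAverage p.1 (p.2 * (1 - p.2 / 2)) ∧
      √(Real.pi * (p.1 * (p.2 * (1 - p.2 / 2)))) *
        charAverage (p.1 - 2) (p.2 * (1 - p.2 / 2)) < 1 + ε := by
    have h := hlow.and hupp
    rw [largeGames, Filter.eventually_inf_principal, Filter.eventually_comap] at h
    obtain ⟨M, hM⟩ := Filter.eventually_atTop.1 h
    exact ⟨M, fun p hp => hM _ hp p rfl⟩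
  refine ⟨M, fun n δ hn hδ hnδ => ?_⟩
  obtain ⟨h1, h2⟩ := hM (n, δ) hnδ ⟨hn, hδ⟩
  have hδ' : 0 < 1 - δ := sub_pos.2 hδ.2
  have hlam1 : charAverage n (δ * (1 - δ / 2)) ≤ (1 - δ)⁻¹ * lam n 2 δ :=
    (le_inv_mul_iff₀ hδ').2 (mul_charAverage_le_lam_two hn hδ)
  have hlam2 : (1 - δ)⁻¹ * lam n 2 δ ≤ charAverage (n - 2) (δ * (1 - δ / 2)) :=
    (inv_mul_le_iff₀ hδ').2 (lam_two_le hδ)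
  have e : (1 - δ)⁻¹ * √(Real.pi * n * δ * (1 - δ / 2)) * lam n 2 δ =
      √(Real.pi * (n * (δ * (1 - δ / 2)))) * ((1 - δ)⁻¹ * lam n 2 δ) := by
    rw [show Real.pi * n * δ * (1 - δ / 2) = Real.pi * (n * (δ * (1 - δ / 2))) by ring]
    ring
  rw [e, abs_sub_lt_iff]
  have hs := Real.sqrt_nonneg (Real.pi * (n * (δ * (1 - δ / 2))))
  have h3 := mul_le_mul_of_nonneg_left hlam1 hs
  have h4 := mul_le_mul_of_nonneg_left hlam2 hs
  constructor <;> linarith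
end

section
/- Every n-player k-action anonymous game g admits an ε-Nash equilibrium in δ-perturbed pure strategies whenever ε ≥ δ + 2k·λ(n,k,δ); that is, there exists a pure strategy profile a ∈ [k]^n such that the mixed profile (a_1^δ,…,a_n^δ) is an ε-Nash equilibrium of g: no player can increase his expected payoff by more than ε by unilaterally deviating to any mixed strategy. -/
open Finset

/-- A mixed strategy over `[k]`: a probability vector. -/
def IsMixed (k : ℕ) (τ : Fin k → ℝ) : Prop :=
  (∀ j, 0 ≤ τ j) ∧ ∑ j, τ j = 1

/-- Expected payoff of player `i` in the game `g` when the players randomise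
independently according to the mixed profile `σ`. -/
noncomputable def expPay (n k : ℕ) (g : (Fin n → Fin k) → Fin n → ℝ)
    (σ : Fin n → Fin k → ℝ) (i : Fin n) : ℝ :=
  ∑ b : Fin n → Fin k, (∏ i', σ i' (b i')) * g b i

/-- `σ` is an `ε`-Nash equilibrium of `g`: no player can gain more than `ε` by
unilaterally deviating to any mixed strategy. -/
def IsEpsNash (n k : ℕ) (ε : ℝ) (g : (Fin n → Fin k) → Fin n → ℝ)
    (σ : Fin n → Fin k → ℝ) : Prop :=
  ∀ (i : Fin n) (τ : Fin k → ℝ), IsMixed k τ →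
    expPay n k g (Function.update σ i τ) i - ε ≤ expPay n k g σ i

section Scarf

variable {X I : Type*}

/-- A set `σ` is dominant for a family of rankings `p` when no `y` is, in every ranking, strictly
above the lowest-ranked element of `σ`. -/
def IsDominant (p : I → X → ℕ) (σ : Finset X) : Prop :=
  ∀ y, ∃ i, ∀ x ∈ σ, p i y ≤ p i x

theorem IsDominant.subset {p : I → X → ℕ} {σ τ : Finset X} (h : IsDominant p σ) (hτ : τ ⊆ σ) :
    IsDominant p τ := fun y => (h y).imp fun _ hi x hx => hi x (hτ hx)

variable [Fintype X] [DecidableEq X] [Fintype I] [DecidableEq I]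

theorem exists_dominant_insert_pair {p : I → X → ℕ} (hp : ∀ i, Function.Injective (p i))
    {τ : Finset X} (hτ : IsDominant p τ) (hcard : τ.card + 1 = Fintype.card I) (hne : τ.Nonempty)
    (hM : ∀ j, ∃ y, ∀ l, l ≠ j → ∃ x ∈ τ, p l x < p l y) :
    ∃ u v, u ≠ v ∧ u ∉ τ ∧ v ∉ τ ∧
      ∀ x, x ∉ τ → (IsDominant p (insert x τ) ↔ x = u ∨ x = v) := by
  choose μ hμ hmin using fun i => τ.exists_min_image (p i) hne
  have hsurj : ∀ x ∈ τ, ∃ i, μ i = x := fun x hx => by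
    obtain ⟨i, hi⟩ := hτ x
    exact ⟨i, hp i (le_antisymm (hmin i x hx) (hi _ (hμ i)))⟩
  obtain ⟨a, -, b, -, hab, hμab⟩ := exists_ne_map_eq_of_card_lt_of_maps_to
    (s := (univ : Finset I)) (t := τ) (by rw [card_univ]; omega) (fun i _ => hμ i)
  have hcount : ∀ j l, l ≠ j → ¬ ∀ x ∈ τ, ∃ m, m ≠ j ∧ m ≠ l ∧ μ m = x := by
    intro j l hl h
    have hsub : τ ⊆ ((univ.erase j).erase l).image μ := by
      intro x hx
      obtain ⟨m, hmj, hml, rfl⟩ := h x hx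
      exact mem_image_of_mem μ (by simp [hmj, hml])
    have h1 := (card_le_card hsub).trans card_image_le
    rw [card_erase_of_mem (by simp [hl]), card_erase_of_mem (mem_univ _), card_univ] at h1
    have := card_pos.2 hne
    omega
  have hpair : ∀ j, (∀ x ∈ τ, ∃ l, l ≠ j ∧ μ l = x) → j = a ∨ j = b := by
    intro j hj
    by_contra! hjab
    refine hcount j a hjab.1.symm fun x hx => ?_
    obtain ⟨l, hl, rfl⟩ := hj x hx
    by_cases hla : l = a
    · exact ⟨b, hjab.2.symm, hab.symm, by rw [hla, hμab]⟩
    · exact ⟨l, hl, hla, rfl⟩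
  have hmax : ∀ j, ∃ x, (∀ l, l ≠ j → p l (μ l) < p l x) ∧
      ∀ y, (∀ l, l ≠ j → p l (μ l) < p l y) → p j y ≤ p j x := by
    intro j
    obtain ⟨y, hy⟩ := hM j
    obtain ⟨x, hx, hx'⟩ := (univ.filter fun y => ∀ l, l ≠ j → p l (μ l) < p l y).exists_max_image
      (p j) ⟨y, mem_filter.2 ⟨mem_univ _, fun l hl => by
        obtain ⟨x, hx, hxy⟩ := hy l hl
        exact (hmin l x hx).trans_lt hxy⟩⟩
    exact ⟨x, (mem_filter.1 hx).2, fun y hy => hx' y (mem_filter.2 ⟨mem_univ _, hy⟩)⟩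
  choose u hu humax using hmax
  have hlow : ∀ j, p j (u j) ≤ p j (μ j) := by
    intro j
    obtain ⟨l, hl⟩ := hτ (u j)
    by_cases hlj : l = j
    · subst hlj; exact hl _ (hμ l)
    · exact absurd (hl _ (hμ l)) (not_le.2 (hu j l hlj))
  have hnot : ∀ j j', j ≠ j' → μ j = μ j' → u j ∉ τ := by
    intro j j' hjj h hmem
    have h1 : u j = μ j := hp j (le_antisymm (hlow j) (hmin j _ hmem))
    have h2 := hu j j' hjj.symm
    rw [h1, h] at h2
    exact lt_irrefl _ h2
  have hdom : ∀ j, IsDominant p (insert (u j) τ) := by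
    intro j y
    by_cases hy : ∀ l, l ≠ j → p l (μ l) < p l y
    · refine ⟨j, fun x hx => ?_⟩
      rcases mem_insert.1 hx with rfl | hx
      · exact humax j y hy
      · exact (humax j y hy).trans ((hlow j).trans (hmin j x hx))
    · push Not at hy
      obtain ⟨l, hl, hly⟩ := hy
      refine ⟨l, fun x hx => ?_⟩
      rcases mem_insert.1 hx with rfl | hx
      · exact hly.trans (hu j l hl).le
      · exact hly.trans (hmin l x hx)
  refine ⟨u a, u b, ?_, hnot a b hab hμab, hnot b a hab.symm hμab.symm, fun x hx => ⟨?_, ?_⟩⟩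
  · intro h
    have := hu b a hab
    rw [← h] at this
    exact absurd (hlow a) (not_le.2 this)
  · intro hd
    obtain ⟨j, hj⟩ := hd x
    have hxj : p j x < p j (μ j) := lt_of_le_of_ne (hj _ (mem_insert_of_mem (hμ j)))
      fun h => hx (hp j h ▸ hμ j)
    have hlow_ne : ∀ z ∈ τ, ∃ l, p l (μ l) < p l x ∧ μ l = z := by
      intro z hz
      obtain ⟨l, hl⟩ := hd z
      have hμz : μ l = z := hp l (le_antisymm (hmin l z hz) (hl _ (mem_insert_of_mem (hμ l))))
      refine ⟨l, lt_of_le_of_ne (hμz ▸ hl x (mem_insert_self _ _)) fun h => hx ?_, hμz⟩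
      exact hp l h ▸ hμ l
    have hother : ∀ z ∈ τ, ∃ l, l ≠ j ∧ μ l = z := by
      intro z hz
      obtain ⟨l, hl, hlz⟩ := hlow_ne z hz
      exact ⟨l, by rintro rfl; exact lt_asymm hl hxj, hlz⟩
    have hxl : ∀ l, l ≠ j → p l (μ l) < p l x := by
      intro l hlj
      by_contra! hl
      refine hcount j l hlj fun z hz => ?_
      obtain ⟨m, hm, hmz⟩ := hlow_ne z hz
      refine ⟨m, ?_, ?_, hmz⟩
      · rintro rfl; exact lt_asymm hm hxj
      · rintro rfl; exact absurd hm (not_lt.2 hl)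
    have hxu : x = u j := by
      refine hp j (le_antisymm (humax j x hxl) ?_)
      obtain ⟨l, hl⟩ := hd (u j)
      by_cases hlj : l = j
      · subst hlj; exact hl x (mem_insert_self _ _)
      · exact absurd (hl _ (mem_insert_of_mem (hμ l))) (not_le.2 (hu j l hlj))
    rcases hpair j hother with rfl | rfl
    · exact Or.inl hxu
    · exact Or.inr hxu
  · rintro (rfl | rfl)
    · exact hdom a
    · exact hdom b

/-- Scarf's combinatorial theorem: with one slack element `d i` per ranking `i`, which is lowest in
ranking `i` and above all non-slack elements in the other rankings, every colouring that gives
`d i` the colour `i` admits a dominant set carrying every colour. -/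
theorem exists_dominant_colorful {p : I → X → ℕ} (hp : ∀ i, Function.Injective (p i))
    {d : I → X} (hdlow : ∀ i x, x ≠ d i → p i (d i) < p i x)
    (hdhigh : ∀ i j x, j ≠ i → x ∉ Set.range d → p i x < p i (d j))
    (hX : ∃ x, x ∉ Set.range d) {c : X → I} (hc : ∀ i, c (d i) = i) [Nontrivial I] :
    ∃ σ : Finset X, IsDominant p σ ∧ ∀ i, ∃ x ∈ σ, c x = i := by
  classical
  obtain ⟨i₀⟩ : Nonempty I := inferInstance
  have hI : 1 < Fintype.card I := Fintype.one_lt_card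
  set R : Finset (Finset X) :=
    univ.filter fun σ => IsDominant p σ ∧ σ.card = Fintype.card I with hR
  set D : Finset (Finset X) :=
    univ.filter fun τ => τ.card + 1 = Fintype.card I ∧ τ.image c = univ.erase i₀ with hD
  have hins : ∀ τ ∈ D, ∀ σ, (σ ∈ R ∧ τ ⊆ σ) ↔ ∃ x, x ∉ τ ∧ IsDominant p (insert x τ) ∧
      σ = insert x τ := by
    intro τ hτ σ
    have hτc := (mem_filter.1 hτ).2.1
    constructor
    · rintro ⟨hσ, hsub⟩
      obtain ⟨-, hdom, hcard⟩ := mem_filter.1 hσ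
      obtain ⟨x, hx, rfl⟩ := exists_eq_insert_iff.2 ⟨hsub, by omega⟩
      exact ⟨x, hx, hdom, rfl⟩
    · rintro ⟨x, hx, hdom, rfl⟩
      exact ⟨mem_filter.2 ⟨mem_univ _, hdom, by rw [card_insert_of_notMem hx, hτc]⟩,
        subset_insert _ _⟩
  set τ₀ : Finset X := (univ.erase i₀).image d with hτ₀
  have hdinj : Function.Injective d := fun i j h => by rw [← hc i, h, hc]
  have hτ₀D : τ₀ ∈ D := by
    refine mem_filter.2 ⟨mem_univ _, ?_, ?_⟩
    · rw [hτ₀, card_image_of_injective _ hdinj, card_erase_of_mem (mem_univ _), card_univ]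
      omega
    · rw [hτ₀, image_image, show c ∘ d = id from funext hc, image_id]
  have houter : (R.filter fun σ => τ₀ ⊆ σ).card = 1 := by
    obtain ⟨y₀, hy₀⟩ := hX
    obtain ⟨m, hm, hmmax⟩ := (univ.filter fun x => x ∉ Set.range d).exists_max_image (p i₀)
      ⟨y₀, mem_filter.2 ⟨mem_univ _, hy₀⟩⟩
    have hm' : m ∉ Set.range d := (mem_filter.1 hm).2
    rw [card_eq_one]
    refine ⟨insert m τ₀, ?_⟩
    ext σ
    rw [mem_filter, hins _ hτ₀D, mem_singleton]
    have hmem : ∀ j, j ≠ i₀ → d j ∈ τ₀ := fun j hj => mem_image_of_mem d (by simp [hj])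
    constructor
    · rintro ⟨x, hx, hdom, rfl⟩
      congr 1
      have hxd : x ∉ Set.range d := by
        rintro ⟨j, rfl⟩
        obtain ⟨i, hi⟩ := hdom y₀
        have : d i ∈ insert (d j) τ₀ := by
          by_cases hii : i = i₀
          · by_cases hji : j = i₀
            · simp [hii, hji]
            · exact absurd (hmem j hji) hx
          · exact mem_insert_of_mem (hmem i hii)
        exact absurd (hi _ this) (not_le.2 (hdlow i _ fun h => hy₀ ⟨i, h.symm⟩))
      obtain ⟨i, hi⟩ := hdom m
      have hii : i = i₀ := by
        by_contra hii
        exact absurd (hi _ (mem_insert_of_mem (hmem i hii)))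
          (not_le.2 (hdlow i _ fun h => hm' ⟨i, h.symm⟩))
      subst hii
      exact hp i (le_antisymm (hmmax x (mem_filter.2 ⟨mem_univ _, hxd⟩))
        (hi _ (mem_insert_self _ _)))
    · rintro rfl
      refine ⟨m, ?_, fun y => ?_, rfl⟩
      · intro h
        obtain ⟨j, -, hj⟩ := mem_image.1 h
        exact hm' ⟨j, hj⟩
      · have key : ∀ x ∈ τ₀, p i₀ m < p i₀ x := by
          intro x hx
          obtain ⟨j, hj, rfl⟩ := mem_image.1 hx
          exact hdhigh i₀ j m (ne_of_mem_erase hj) hm'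
        by_cases hy : ∃ j, j ≠ i₀ ∧ d j = y
        · obtain ⟨j, -, rfl⟩ := hy
          refine ⟨j, fun x _ => ?_⟩
          by_cases hxj : x = d j
          · rw [hxj]
          · exact (hdlow j x hxj).le
        · have hym : p i₀ y ≤ p i₀ m := by
            by_cases hyd : y ∈ Set.range d
            · obtain ⟨j, rfl⟩ := hyd
              have : j = i₀ := by
                by_contra h
                exact hy ⟨j, h, rfl⟩
              rw [this]
              exact (hdlow i₀ m fun h => hm' ⟨i₀, h.symm⟩).le
            · exact hmmax y (mem_filter.2 ⟨mem_univ _, hyd⟩)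
          refine ⟨i₀, fun x hx => ?_⟩
          rcases mem_insert.1 hx with rfl | hx
          · exact hym
          · exact hym.trans (key x hx).le
  have hinner : ∀ τ ∈ D, τ ≠ τ₀ → Even (R.filter fun σ => τ ⊆ σ).card := by
    intro τ hτ hne
    obtain ⟨-, hcard, himg⟩ := mem_filter.1 hτ
    by_cases hdom : IsDominant p τ
    swap
    · have : (R.filter fun σ => τ ⊆ σ) = ∅ := by
        refine filter_eq_empty_iff.2 fun σ hσ hsub => hdom ?_
        exact (mem_filter.1 hσ).2.1.subset hsub
      simp [this]
    obtain ⟨z, hz, hzd⟩ : ∃ z ∈ τ, z ∉ Set.range d := by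
      by_contra! h
      refine hne (eq_of_subset_of_card_le (fun x hx => ?_) ?_)
      · obtain ⟨j, rfl⟩ := h x hx
        have : c (d j) ∈ univ.erase i₀ := himg ▸ mem_image_of_mem c hx
        rw [hc] at this
        exact mem_image_of_mem d this
      · have := (mem_filter.1 hτ₀D).2.1
        omega
    obtain ⟨u, v, huv, hu, hv, hx⟩ := exists_dominant_insert_pair hp hdom hcard ⟨z, hz⟩
      fun j => ⟨d j, fun l hl => ⟨z, hz, hdhigh l j z hl.symm hzd⟩⟩
    have : (R.filter fun σ => τ ⊆ σ) = {insert u τ, insert v τ} := by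
      ext σ
      rw [mem_filter, hins τ hτ, mem_insert, mem_singleton]
      constructor
      · rintro ⟨x, hxτ, hxd, rfl⟩
        rcases (hx x hxτ).1 hxd with rfl | rfl <;> simp
      · rintro (rfl | rfl)
        · exact ⟨u, hu, (hx u hu).2 (Or.inl rfl), rfl⟩
        · exact ⟨v, hv, (hx v hv).2 (Or.inr rfl), rfl⟩
    rw [this, card_pair]
    · exact even_two
    · intro h
      have : u ∈ insert v τ := h ▸ mem_insert_self _ _
      rcases mem_insert.1 this with h | h
      · exact huv h
      · exact hu h
  have hodd : Odd (∑ σ ∈ R, (D.filter fun τ => τ ⊆ σ).card) := by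
    have hdc := sum_card_bipartiteAbove_eq_sum_card_bipartiteBelow
      (fun (τ σ : Finset X) => τ ⊆ σ) (s := D) (t := R)
    simp only [bipartiteAbove, bipartiteBelow] at hdc
    rw [← hdc, odd_sum_iff_odd_card_odd]
    have : (D.filter fun τ => Odd (R.filter fun σ => τ ⊆ σ).card) = {τ₀} := by
      ext τ
      rw [mem_filter, mem_singleton]
      constructor
      · rintro ⟨hτ, ho⟩
        by_contra hne
        exact Nat.not_odd_iff_even.2 (hinner τ hτ hne) ho
      · rintro rfl
        exact ⟨hτ₀D, by rw [houter]; exact odd_one⟩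
    rw [this]
    simp
  rw [odd_sum_iff_odd_card_odd] at hodd
  obtain ⟨σ, hσ⟩ := card_pos.1 hodd.pos
  obtain ⟨hσR, hσodd⟩ := mem_filter.1 hσ
  obtain ⟨-, hσdom, hσcard⟩ := mem_filter.1 hσR
  refine ⟨σ, hσdom, ?_⟩
  by_contra! hmiss
  obtain ⟨τ, hτ⟩ := card_pos.1 hσodd.pos
  obtain ⟨hτD, hτσ⟩ := mem_filter.1 hτ
  obtain ⟨-, hτc, himg⟩ := mem_filter.1 hτD
  obtain ⟨x, hxτ, hxdom, rfl⟩ := (hins τ hτD σ).1 ⟨hσR, hτσ⟩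
  have hcolor : ∀ i, i ≠ i₀ → ∃ z ∈ τ, c z = i := fun i hi =>
    mem_image.1 (himg ▸ mem_erase.2 ⟨hi, mem_univ i⟩)
  have hxi : c x ≠ i₀ := by
    intro hxi
    obtain ⟨i, hi⟩ := hmiss
    by_cases hii : i = i₀
    · exact hi x (mem_insert_self _ _) (hxi.trans hii.symm)
    · obtain ⟨z, hz, hzi⟩ := hcolor i hii
      exact hi z (mem_insert_of_mem hz) hzi
  obtain ⟨z, hz, hzx⟩ := hcolor _ hxi
  have hzne : z ≠ x := by rintro rfl; exact hxτ hz
  have hinj : Set.InjOn c τ := by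
    refine card_image_iff.1 ?_
    rw [himg, card_erase_of_mem (mem_univ _), card_univ]
    omega
  have hpair : (D.filter fun τ' => τ' ⊆ insert x τ) = {τ, (insert x τ).erase z} := by
    ext τ'
    rw [mem_filter, mem_insert, mem_singleton]
    constructor
    · rintro ⟨hτ', hsub⟩
      obtain ⟨-, hτ'c, himg'⟩ := mem_filter.1 hτ'
      have hinj' : Set.InjOn c τ' := by
        refine card_image_iff.1 ?_
        rw [himg', card_erase_of_mem (mem_univ _), card_univ]
        omega
      by_cases hx' : x ∈ τ'
      · right
        refine eq_of_subset_of_card_le (fun w hw => mem_erase.2 ⟨?_, hsub hw⟩) ?_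
        · rintro rfl
          exact hzne (hinj' hw hx' hzx)
        · rw [card_erase_of_mem (mem_insert_of_mem hz), card_insert_of_notMem hxτ]
          omega
      · left
        refine eq_of_subset_of_card_le (fun w hw => ?_) (by omega)
        rcases mem_insert.1 (hsub hw) with rfl | h
        · exact absurd hw hx'
        · exact h
    · rintro (rfl | rfl)
      · exact ⟨hτD, subset_insert _ _⟩
      · refine ⟨mem_filter.2 ⟨mem_univ _, ?_, ?_⟩, erase_subset _ _⟩
        · rw [card_erase_of_mem (mem_insert_of_mem hz), card_insert_of_notMem hxτ]
          omega
        · rw [← himg]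
          ext i
          simp only [mem_image, mem_erase, mem_insert]
          constructor
          · rintro ⟨w, ⟨hwz, rfl | hw⟩, rfl⟩
            · exact ⟨z, hz, hzx⟩
            · exact ⟨w, hw, rfl⟩
          · rintro ⟨w, hw, rfl⟩
            by_cases hwz : w = z
            · exact ⟨x, ⟨hzne.symm, Or.inl rfl⟩, by rw [hwz, hzx]⟩
            · exact ⟨w, ⟨hwz, Or.inr hw⟩, rfl⟩
  rw [hpair, card_pair] at hσodd
  · exact absurd hσodd (by decide)
  · intro h
    exact absurd (h ▸ hz) (notMem_erase z _)

end Scarf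

section Brouwer

variable {ι : Type*} [Fintype ι] [DecidableEq ι]

/-- The nonnegative integer points with coordinate sum `N`. -/
abbrev SimplexGrid (ι : Type*) [Fintype ι] (N : ℕ) : Type _ :=
  {x : ι → ℕ // ∑ i, x i = N}

/-- A Sperner-type lemma on `SimplexGrid ι N`. -/
theorem exists_close_colorful [Nontrivial ι] (N : ℕ)
    (c : SimplexGrid ι N → ι) :
    ∃ w : SimplexGrid ι N, ∀ i, w.1 i ≤ Fintype.card ι ∨
      ∃ z, c z = i ∧ ∀ j, z.1 j ≤ w.1 j + Fintype.card ι ∧ w.1 j ≤ z.1 j + Fintype.card ι := by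
  classical
  have hle : ∀ (x : SimplexGrid ι N) i, x.1 i ≤ N := fun x i =>
    (single_le_sum (f := x.1) (fun _ _ => Nat.zero_le _) (mem_univ i)).trans x.2.le
  have : Fintype (SimplexGrid ι N) := Fintype.ofInjective
    (fun (x : SimplexGrid ι N) (i : ι) => (⟨x.1 i, Nat.lt_succ_of_le (hle x i)⟩ : Fin (N + 1)))
    fun x y h => Subtype.ext (funext fun i => congrArg Fin.val (congrFun h i))
  set M := Fintype.card (SimplexGrid ι N)
  set e : SimplexGrid ι N → ℕ := fun x => Fintype.equivFin (SimplexGrid ι N) x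
  have he : ∀ x, e x < M := fun x => (Fintype.equivFin (SimplexGrid ι N) x).2
  have heinj : Function.Injective e := Fin.val_injective.comp
    (Fintype.equivFin (SimplexGrid ι N)).injective
  set f : ι → ℕ := fun i => Fintype.equivFin ι i
  have hfinj : Function.Injective f := Fin.val_injective.comp (Fintype.equivFin ι).injective
  set p : ι → SimplexGrid ι N ⊕ ι → ℕ := fun i => Sum.elim (fun x => x.1 i * M + e x + 1)
    (fun j => if j = i then 0 else (N + 1) * M + 1 + f j) with hp
  have hpl : ∀ i x, p i (Sum.inl x) = x.1 i * M + e x + 1 := fun _ _ => rfl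
  have hpr : ∀ i j, j ≠ i → p i (Sum.inr j) = (N + 1) * M + 1 + f j := fun i j h => by simp [hp, h]
  have hpr0 : ∀ i, p i (Sum.inr i) = 0 := fun i => by simp [hp]
  have hhigh : ∀ i x, p i (Sum.inl x) < (N + 1) * M + 1 := by
    intro i x
    have := Nat.mul_le_mul_right M (hle x i)
    have := he x
    rw [hpl, add_mul]
    omega
  have hlt : ∀ i x y, p i (Sum.inl x) ≤ p i (Sum.inl y) → x.1 i ≤ y.1 i := by
    intro i x y h
    rw [hpl, hpl] at h
    by_contra! hxy
    have := Nat.mul_le_mul_right M (Nat.succ_le_of_lt hxy)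
    have := he y
    rw [Nat.succ_mul] at *
    omega
  have hinj : ∀ i, Function.Injective (p i) := by
    rintro i (x | j) (y | l) h
    · have h1 := le_antisymm (hlt i x y h.le) (hlt i y x h.ge)
      rw [hpl, hpl, h1] at h
      rw [heinj (by omega : e x = e y)]
    · by_cases hl : l = i
      · subst hl; rw [hpl, hpr0] at h; omega
      · have := hhigh i x
        rw [h, hpr i l hl] at this; omega
    · by_cases hl : j = i
      · subst hl; rw [hpl, hpr0] at h; omega
      · have := hhigh i y
        rw [← h, hpr i j hl] at this; omega
    · by_cases hj : j = i <;> by_cases hl : l = i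
      · rw [hj, hl]
      · subst hj; rw [hpr0, hpr _ _ hl] at h; omega
      · subst hl; rw [hpr0, hpr _ _ hj] at h; omega
      · rw [hpr _ _ hj, hpr _ _ hl] at h
        rw [hfinj (by omega : f j = f l)]
  have hrange : ∀ x : SimplexGrid ι N ⊕ ι, x ∉ Set.range (Sum.inr : ι → SimplexGrid ι N ⊕ ι) →
      ∃ y, x = Sum.inl y := by
    rintro (y | j) h
    · exact ⟨y, rfl⟩
    · exact absurd ⟨j, rfl⟩ h
  obtain ⟨i₁⟩ : Nonempty ι := inferInstance
  have hsum : ∀ (i : ι) (y : ι → ℕ), ∑ j, y j ≤ N →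
      ∃ z : SimplexGrid ι N, ∀ j, y j ≤ z.1 j := by
    intro i y hy
    refine ⟨⟨y + Pi.single i (N - ∑ j, y j), ?_⟩, fun j => ?_⟩
    · simp only [Pi.add_apply, sum_add_distrib, Fintype.sum_pi_single']
      omega
    · simp
  obtain ⟨t₀, -⟩ := hsum i₁ 0 (by simp)
  obtain ⟨σ, hσ, hcol⟩ := exists_dominant_colorful hinj (d := Sum.inr)
    (fun i x hx => by
      rw [hpr0]
      rcases x with x | j
      · rw [hpl]; omega
      · rw [hpr i j fun h => hx (by rw [h])]; omega)
    (fun i j x hj hx => by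
      obtain ⟨y, rfl⟩ := hrange x hx
      rw [hpr i j hj]
      exact (hhigh i y).trans_le (by omega))
    ⟨Sum.inl t₀, by simp⟩ (c := Sum.elim c id) (fun _ => rfl)
  set C : Finset ι := univ.filter fun i => Sum.inr i ∉ σ
  have hdomT : ∀ y : SimplexGrid ι N, ∃ i ∈ C, ∀ x : SimplexGrid ι N, Sum.inl x ∈ σ →
      y.1 i ≤ x.1 i := by
    intro y
    obtain ⟨i, hi⟩ := hσ (Sum.inl y)
    refine ⟨i, mem_filter.2 ⟨mem_univ _, fun h => ?_⟩, fun x hx => hlt i y x (hi _ hx)⟩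
    have := hi _ h
    rw [hpr0, hpl] at this
    omega
  have hCcol : ∀ i ∈ C, ∃ z : SimplexGrid ι N, Sum.inl z ∈ σ ∧ c z = i := by
    intro i hi
    obtain ⟨x | j, hx, hxi⟩ := hcol i
    · exact ⟨x, hx, hxi⟩
    · exact absurd ((show j = i from hxi) ▸ hx) (mem_filter.1 hi).2
  obtain ⟨i₂, hi₂, -⟩ := hdomT t₀
  obtain ⟨w, hw, -⟩ := hCcol i₂ hi₂
  set S : Finset (SimplexGrid ι N) := univ.filter fun x => Sum.inl x ∈ σ
  have hS : ∀ {x}, x ∈ S ↔ Sum.inl x ∈ σ := by simp [S]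
  choose m hmS hm using fun i => S.exists_min_image (fun x => x.1 i) ⟨w, hS.2 hw⟩
  have hlarge : N < ∑ i ∈ C, ((m i).1 i + 1) := by
    by_contra! h
    obtain ⟨y, hy⟩ := hsum i₂ (fun i => if i ∈ C then (m i).1 i + 1 else 0)
      (by rwa [← sum_filter, filter_mem_eq_inter, univ_inter])
    obtain ⟨i, hi, hle⟩ := hdomT y
    have h1 := hle _ (hS.1 (hmS i))
    have h2 := hy i
    rw [if_pos hi] at h2
    omega
  rw [sum_add_distrib, sum_const, smul_eq_mul, mul_one] at hlarge
  have hCcard : C.card ≤ Fintype.card ι := card_le_univ C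
  have hnear : ∀ x ∈ S, (∀ j ∉ C, x.1 j ≤ Fintype.card ι) ∧
      ∀ j ∈ C, x.1 j ≤ (m j).1 j + Fintype.card ι := by
    intro x hx
    have hx2 := x.2
    rw [← sum_add_sum_compl C] at hx2
    constructor
    · intro j hj
      have h1 : ∑ i ∈ C, (m i).1 i ≤ ∑ i ∈ C, x.1 i := sum_le_sum fun i _ => hm i x hx
      have h2 := single_le_sum (f := x.1) (fun _ _ => Nat.zero_le _) (mem_compl.2 hj)
      omega
    · intro j hj
      have h1 : ∑ i ∈ C.erase j, (m i).1 i ≤ ∑ i ∈ C.erase j, x.1 i :=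
        sum_le_sum fun i _ => hm i x hx
      rw [← add_sum_erase C _ hj] at hx2 hlarge
      omega
  refine ⟨w, fun i => ?_⟩
  by_cases hi : i ∈ C
  · right
    obtain ⟨z, hz, hzi⟩ := hCcol i hi
    refine ⟨z, hzi, fun j => ?_⟩
    by_cases hj : j ∈ C
    · have h1 := (hnear z (hS.2 hz)).2 j hj
      have h2 := (hnear w (hS.2 hw)).2 j hj
      have h3 := hm j z (hS.2 hz)
      have h4 := hm j w (hS.2 hw)
      omega
    · have h1 := (hnear z (hS.2 hz)).1 j hj
      have h2 := (hnear w (hS.2 hw)).1 j hj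
      omega
  · exact Or.inl ((hnear w (hS.2 hw)).1 i hi)

/-- Brouwer's fixed point theorem for the standard simplex. -/
theorem exists_fixedPoint_stdSimplex [Nonempty ι] {f : (ι → ℝ) → ι → ℝ}
    (hf : ContinuousOn f (stdSimplex ℝ ι))
    (hmaps : Set.MapsTo f (stdSimplex ℝ ι) (stdSimplex ℝ ι)) :
    ∃ x ∈ stdSimplex ℝ ι, f x = x := by
  suffices h : ∃ x ∈ stdSimplex ℝ ι, ∀ i, x i ≤ f x i by
    obtain ⟨x, hx, hle⟩ := h
    refine ⟨x, hx, funext fun i => ?_⟩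
    have := (sum_eq_sum_iff_of_le fun i _ => hle i).1 (hx.2.trans (hmaps hx).2.symm)
    exact (this i (mem_univ i)).symm
  rcases subsingleton_or_nontrivial ι with hι | hι
  · obtain ⟨i₀⟩ := ‹Nonempty ι›
    refine ⟨_, ite_eq_mem_stdSimplex ℝ i₀, fun i => ?_⟩
    have h1 := (ite_eq_mem_stdSimplex ℝ i₀).2
    have h2 := (hmaps (ite_eq_mem_stdSimplex ℝ i₀)).2
    rw [Fintype.sum_subsingleton _ i] at h1 h2
    exact (h1.trans h2.symm).le
  have hK := isCompact_stdSimplex ℝ ι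
  have hcont : ContinuousOn (fun x => univ.sup' univ_nonempty fun i => x i - f x i)
      (stdSimplex ℝ ι) := by
    refine ContinuousOn.finset_sup'_apply _ fun i _ => ?_
    exact (continuous_apply i).continuousOn.sub ((continuous_apply i).comp_continuousOn hf)
  obtain ⟨x, hx, hmin⟩ := hK.exists_isMinOn
    ⟨_, ite_eq_mem_stdSimplex ℝ (Classical.arbitrary ι)⟩ hcont
  refine ⟨x, hx, fun i => ?_⟩
  rw [← sub_nonpos]
  refine (le_sup' (fun i => x i - f x i) (mem_univ i)).trans (le_of_forall_pos_le_add fun η hη => ?_)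
  rw [zero_add]
  suffices h : ∃ w ∈ stdSimplex ℝ ι, ∀ i, w i - f w i ≤ η by
    obtain ⟨w, hw, hwη⟩ := h
    exact (hmin hw).trans (sup'_le _ _ fun i _ => hwη i)
  obtain ⟨ρ, hρ, hunif⟩ := Metric.uniformContinuousOn_iff.1
    (hK.uniformContinuousOn_of_continuous hf) (η / 2) (half_pos hη)
  obtain ⟨N, hN⟩ := exists_nat_gt ((Fintype.card ι : ℝ) / min ρ (η / 2))
  have hmpos : 0 < min ρ (η / 2) := lt_min hρ (half_pos hη)
  have hN0 : (0 : ℝ) < N := lt_of_le_of_lt (by positivity) hN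
  have hsmall : (Fintype.card ι : ℝ) / N < min ρ (η / 2) := by
    rw [div_lt_iff₀ hmpos] at hN
    rw [div_lt_iff₀ hN0]
    linarith
  set q : SimplexGrid ι N → ι → ℝ := fun x i => x.1 i / N
  have hq : ∀ x, q x ∈ stdSimplex ℝ ι := fun x => by
    refine ⟨fun i => by positivity, ?_⟩
    rw [← sum_div, ← Nat.cast_sum, x.2, div_self hN0.ne']
  have hcolor : ∀ x, ∃ i, q x i ≤ f (q x) i := fun x => by
    obtain ⟨i, -, hi⟩ := exists_le_of_sum_le (univ_nonempty (α := ι))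
      ((hq x).2.trans (hmaps (hq x)).2.symm).le
    exact ⟨i, hi⟩
  choose c hc using hcolor
  obtain ⟨w, hw⟩ := exists_close_colorful N c
  refine ⟨q w, hq w, fun i => ?_⟩
  rcases hw i with hwi | ⟨z, rfl, hz⟩
  · have h1 : q w i ≤ Fintype.card ι / N := by
      have : (w.1 i : ℝ) ≤ Fintype.card ι := by exact_mod_cast hwi
      exact div_le_div_of_nonneg_right this hN0.le
    have h2 := (hmaps (hq w)).1 i
    have h3 := hsmall.trans_le (min_le_right _ _)
    linarith
  · have hclose : ∀ j, |q z j - q w j| ≤ Fintype.card ι / N := by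
      intro j
      have h1 : (z.1 j : ℝ) ≤ w.1 j + Fintype.card ι := by exact_mod_cast (hz j).1
      have h2 : (w.1 j : ℝ) ≤ z.1 j + Fintype.card ι := by exact_mod_cast (hz j).2
      rw [show q z j - q w j = ((z.1 j : ℝ) - w.1 j) / N from (sub_div _ _ _).symm, abs_div,
        abs_of_pos hN0]
      exact div_le_div_of_nonneg_right (abs_le.2 ⟨by linarith, by linarith⟩) hN0.le
    have hd : dist (q z) (q w) < ρ := (dist_pi_lt_iff hρ).2 fun j => by
      rw [Real.dist_eq]
      exact (hclose j).trans_lt (hsmall.trans_le (min_le_left _ _))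
    have h1 := (dist_le_pi_dist _ _ (c z)).trans_lt (hunif _ (hq z) _ (hq w) hd)
    rw [Real.dist_eq] at h1
    have h2 := (abs_lt.1 h1).2
    have h3 := (abs_le.1 (hclose (c z))).1
    have h4 := hc z
    have h5 := hsmall.trans_le (min_le_right _ _)
    linarith

end Brouwer

section Rounding

variable {α β : Type*} [Fintype α] [Fintype β]

theorem exists_support_ssubset {s t : α → β → ℝ} (hs : ∀ i, s i ∈ stdSimplex ℝ β) (ht : t ≠ 0)
    (hts : ∀ i j, s i j = 0 → t i j = 0) (hrow : ∀ i, ∑ j, t i j = 0)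
    (hcol : ∀ j, ∑ i, t i j = 0) :
    ∃ r : α → β → ℝ, (∀ i, r i ∈ stdSimplex ℝ β) ∧ (∀ j, ∑ i, r i j = ∑ i, s i j) ∧
      (∀ i j, s i j = 0 → r i j = 0) ∧ ∃ i j, s i j ≠ 0 ∧ r i j = 0 := by
  obtain ⟨i₀, j₀, hneg⟩ : ∃ i j, t i j < 0 := by
    by_contra! h
    refine ht (funext fun i => funext fun j => ?_)
    exact (sum_eq_zero_iff_of_nonneg fun j _ => h i j).1 (hrow i) j (mem_univ j)
  obtain ⟨⟨a, b⟩, hab, hmin⟩ := (univ.filter fun q : α × β => t q.1 q.2 < 0).exists_min_image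
    (fun q => s q.1 q.2 / -t q.1 q.2) ⟨(i₀, j₀), by simpa using hneg⟩
  simp only [mem_filter, mem_univ, true_and] at hab hmin
  have hθ : 0 ≤ s a b / -t a b := div_nonneg ((hs a).1 b) (by linarith)
  refine ⟨fun i j => s i j + s a b / -t a b * t i j, fun i => ⟨fun j => ?_, ?_⟩, fun j => ?_,
    fun i j h => ?_, a, b, fun h => hab.ne (hts a b h), ?_⟩
  · rcases le_or_gt 0 (t i j) with h | h
    · exact add_nonneg ((hs i).1 j) (mul_nonneg hθ h)
    · have := hmin (i, j) h
      rw [le_div_iff₀ (by linarith)] at this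
      simp only at this
      linarith
  · rw [sum_add_distrib, ← mul_sum, hrow, mul_zero, add_zero, (hs i).2]
  · rw [sum_add_distrib, ← mul_sum, hcol, mul_zero, add_zero]
  · simp [h, hts i j h]
  · have : t a b ≠ 0 := hab.ne
    simp only
    field_simp
    ring

variable [DecidableEq β]

theorem exists_ne_zero_sums_eq_zero [Nonempty β] (E : Finset (α × β))
    (hE : Fintype.card α + (Fintype.card β - 1) < E.card) :
    ∃ t : α → β → ℝ, t ≠ 0 ∧ (∀ i j, (i, j) ∉ E → t i j = 0) ∧
      (∀ i, ∑ j, t i j = 0) ∧ ∀ j, ∑ i, t i j = 0 := by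
  obtain ⟨j₀⟩ := ‹Nonempty β›
  let ext : (E → ℝ) →ₗ[ℝ] (α × β → ℝ) :=
    Function.ExtendByZero.linearMap ℝ (Subtype.val : E → α × β)
  let row : (α × β → ℝ) →ₗ[ℝ] (α → ℝ) :=
    LinearMap.pi fun i => ∑ j, LinearMap.proj (i, j)
  let col : (α × β → ℝ) →ₗ[ℝ] ({j // j ≠ j₀} → ℝ) :=
    LinearMap.pi fun j => ∑ i, LinearMap.proj (i, j.1)
  have hker : LinearMap.ker ((row.prod col).comp ext) ≠ ⊥ := by
    refine LinearMap.ker_ne_bot_of_finrank_lt ?_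
    simpa [Fintype.card_subtype_compl] using hE
  obtain ⟨u, hu, hu0⟩ := (Submodule.ne_bot_iff _).1 hker
  have hext : ∀ q (hq : q ∈ E), ext u q = u ⟨q, hq⟩ := fun q hq =>
    Subtype.val_injective.extend_apply u 0 ⟨q, hq⟩
  have hext0 : ∀ q, q ∉ E → ext u q = 0 := fun q hq =>
    Function.extend_apply' (f := (Subtype.val : E → α × β)) u (0 : α × β → ℝ) q
      (by rintro ⟨⟨q, h⟩, rfl⟩; exact hq h)
  have hprod : (row.prod col) (ext u) = 0 := hu
  have hrow : ∀ i, ∑ j, ext u (i, j) = 0 := fun i => by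
    have := congrFun (congrArg Prod.fst hprod) i
    simpa [row] using this
  have hcol : ∀ j, j ≠ j₀ → ∑ i, ext u (i, j) = 0 := fun j hj => by
    have := congrFun (congrArg Prod.snd hprod) ⟨j, hj⟩
    simpa [col] using this
  refine ⟨fun i j => ext u (i, j), fun h => hu0 (funext fun q => ?_), fun i j => hext0 _, hrow,
    fun j => ?_⟩
  · rw [← hext q.1 q.2]
    exact congrFun (congrFun h q.1.1) q.1.2
  · by_cases hj : j = j₀
    · subst hj
      have h1 : ∑ l, ∑ i, ext u (i, l) = 0 := by
        rw [sum_comm]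
        exact sum_eq_zero fun i _ => hrow i
      rwa [sum_eq_single j (fun l _ hl => hcol l hl) (by simp)] at h1
    · exact hcol j hj

theorem exists_support_card_le [Nonempty β] (s : α → β → ℝ) (hs : ∀ i, s i ∈ stdSimplex ℝ β) :
    ∃ r : α → β → ℝ, (∀ i, r i ∈ stdSimplex ℝ β) ∧ (∀ j, ∑ i, r i j = ∑ i, s i j) ∧
      (∀ i j, s i j = 0 → r i j = 0) ∧
      (univ.filter fun q : α × β => r q.1 q.2 ≠ 0).card ≤
        Fintype.card α + (Fintype.card β - 1) := by
  induction h : (univ.filter fun q : α × β => s q.1 q.2 ≠ 0).card using Nat.strong_induction_on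
    generalizing s with
  | _ m ih =>
    by_cases hle : m ≤ Fintype.card α + (Fintype.card β - 1)
    · exact ⟨s, hs, fun _ => rfl, fun _ _ => id, h.trans_le hle⟩
    obtain ⟨t, ht, hsupp, hrow, hcol⟩ := exists_ne_zero_sums_eq_zero
      (univ.filter fun q : α × β => s q.1 q.2 ≠ 0) (by omega)
    obtain ⟨r, hr, hrsum, hrs, a, b, hab, hrab⟩ := exists_support_ssubset hs ht
      (fun i j hij => hsupp i j (by simpa using hij)) hrow hcol
    obtain ⟨q, hq, hqsum, hqr, hcard⟩ := ih _ (by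
      rw [← h]
      refine card_lt_card ((ssubset_iff_of_subset ?_).2 ⟨(a, b), by simpa using hab,
        by simpa using hrab⟩)
      intro p hp
      simp only [mem_filter, mem_univ, true_and] at hp ⊢
      exact fun h => hp (hrs _ _ h)) r hr rfl
    exact ⟨q, hq, fun j => (hqsum j).trans (hrsum j), fun i j hij => hqr i j (hrs i j hij), hcard⟩

/-- Mixed strategies can be rounded to pure strategies in their supports so that the expected
number of players per action moves by at most `2 (card β - 1)` in the `ℓ¹` norm. -/
theorem exists_pure_rounding [Nonempty β] (s : α → β → ℝ) (hs : ∀ i, s i ∈ stdSimplex ℝ β) :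
    ∃ a : α → β, (∀ i, 0 < s i (a i)) ∧
      ∑ j, |((univ.filter fun i => a i = j).card : ℝ) - ∑ i, s i j| ≤
        2 * ((Fintype.card β : ℝ) - 1) := by
  obtain ⟨r, hr, hrsum, hrs, hcard⟩ := exists_support_card_le s hs
  have hex : ∀ i, ∃ j, 0 < r i j := by
    intro i
    by_contra! h
    have := (hr i).2
    rw [sum_eq_zero fun j _ => le_antisymm (h j) ((hr i).1 j)] at this
    exact zero_ne_one this
  choose a ha using hex
  set row : α → Finset β := fun i => univ.filter fun j => r i j ≠ 0
  have harow : ∀ i, a i ∈ row i := fun i => by simpa [row] using (ha i).ne'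
  have hrow : ∀ i, ∑ j, |(if a i = j then (1 : ℝ) else 0) - r i j| ≤
      2 * ((row i).card - 1 : ℝ) := by
    intro i
    have hpos := card_pos.2 ⟨_, harow i⟩
    rcases Nat.eq_or_lt_of_le (Nat.succ_le_of_lt hpos) with h1 | h1
    · obtain ⟨j, hj⟩ := card_eq_one.1 h1.symm
      have haj : a i = j := mem_singleton.1 (hj ▸ harow i)
      have hz : ∀ l, l ≠ a i → r i l = 0 := by
        intro l hl
        by_contra h
        have : l ∈ row i := by simpa [row] using h
        rw [hj, mem_singleton] at this
        exact hl (this.trans haj.symm)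
      have hone : r i (a i) = 1 := by
        have := (hr i).2
        rwa [sum_eq_single (a i) (fun l _ hl => hz l hl) (by simp)] at this
      rw [← h1, sum_eq_zero]
      · simp
      · intro l _
        by_cases hl : a i = l
        · simp [← hl, hone]
        · simp [hl, hz l (Ne.symm hl)]
    · have h2 : (2 : ℝ) ≤ (row i).card := by exact_mod_cast h1
      calc ∑ j, |(if a i = j then (1 : ℝ) else 0) - r i j|
          ≤ ∑ j, ((if a i = j then (1 : ℝ) else 0) + r i j) := by
            refine sum_le_sum fun j _ => abs_le.2 ?_
            have := (hr i).1 j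
            split_ifs <;> constructor <;> linarith
        _ = 2 := by rw [sum_add_distrib, (hr i).2]; simp; norm_num
        _ ≤ _ := by linarith
  refine ⟨a, fun i => lt_of_le_of_ne ((hs i).1 _) fun h => (ha i).ne' (hrs _ _ h.symm), ?_⟩
  have hE : (univ.filter fun q : α × β => r q.1 q.2 ≠ 0).card = ∑ i, (row i).card := by
    simp only [row, card_filter]
    exact Fintype.sum_prod_type _
  have hβ : 1 ≤ Fintype.card β := Fintype.card_pos
  calc ∑ j, |((univ.filter fun i => a i = j).card : ℝ) - ∑ i, s i j|
      = ∑ j, |∑ i, ((if a i = j then (1 : ℝ) else 0) - r i j)| := by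
        refine sum_congr rfl fun j _ => ?_
        rw [sum_sub_distrib, hrsum, card_filter]
        push_cast
        rfl
    _ ≤ ∑ j, ∑ i, |(if a i = j then (1 : ℝ) else 0) - r i j| :=
        sum_le_sum fun j _ => abs_sum_le_sum_abs _ _
    _ = ∑ i, ∑ j, |(if a i = j then (1 : ℝ) else 0) - r i j| := sum_comm
    _ ≤ ∑ i, 2 * ((row i).card - 1 : ℝ) := sum_le_sum fun i _ => hrow i
    _ = 2 * ((∑ i, (row i).card : ℕ) - Fintype.card α : ℝ) := by
        rw [← mul_sum, sum_sub_distrib]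
        simp
    _ ≤ _ := by
        rw [← hE]
        have : ((univ.filter fun q : α × β => r q.1 q.2 ≠ 0).card : ℝ) ≤
            Fintype.card α + (Fintype.card β - 1) := by
          rw [← Nat.cast_one, ← Nat.cast_sub hβ]
          exact_mod_cast hcard
        linarith

/-- Near-best replies to a common vector `x` of action counts exist whose own action counts are
close to `x`. -/
theorem exists_near_best_reply_counts [Nonempty β] (v : α → β → (β → ℝ) → ℝ)
    (hv : ∀ i j, Continuous (v i j)) {η : ℝ} (hη : 0 < η) :
    ∃ (x : β → ℝ) (a : α → β), (∀ i j, v i j x ≤ v i (a i) x + η) ∧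
      ∑ j, |((univ.filter fun i => a i = j).card : ℝ) - x j| ≤
        2 * ((Fintype.card β : ℝ) - 1) := by
  rcases isEmpty_or_nonempty α with hα | hα
  · refine ⟨0, isEmptyElim, isEmptyElim, ?_⟩
    have : (1 : ℝ) ≤ Fintype.card β := by exact_mod_cast Fintype.card_pos (α := β)
    simpa using this
  set V : α → (β → ℝ) → ℝ := fun i x => univ.sup' univ_nonempty fun j => v i j x with hV
  have hVc : ∀ i, Continuous (V i) := fun i =>
    Continuous.finset_sup'_apply _ fun j _ => hv i j
  have hle : ∀ i j x, v i j x ≤ V i x := fun i j x => le_sup' (fun j => v i j x) (mem_univ j)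
  set w : α → β → (β → ℝ) → ℝ := fun i j x => max 0 (v i j x - V i x + η) with hw
  have hwc : ∀ i j, Continuous (w i j) := fun i j =>
    continuous_const.max (((hv i j).sub (hVc i)).add continuous_const)
  have hw0 : ∀ i j x, 0 ≤ w i j x := fun i j x => le_max_left _ _
  have hwpos : ∀ i x, 0 < ∑ j, w i j x := by
    intro i x
    obtain ⟨j, -, hj⟩ := exists_mem_eq_sup' univ_nonempty fun j => v i j x
    refine sum_pos' (fun j _ => hw0 i j x) ⟨j, mem_univ j, lt_max_of_lt_right ?_⟩
    rw [show V i x = v i j x from hj]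
    simpa using hη
  set s : (β → ℝ) → α → β → ℝ := fun x i j => w i j x / ∑ l, w i l x with hsdef
  have hs : ∀ x i, s x i ∈ stdSimplex ℝ β := fun x i =>
    ⟨fun j => div_nonneg (hw0 i j x) (hwpos i x).le, by
      rw [hsdef, ← sum_div, div_self (hwpos i x).ne']⟩
  have hsc : ∀ i j, Continuous fun x => s x i j := fun i j =>
    (hwc i j).div (continuous_finsetSum _ fun l _ => hwc i l) fun x => (hwpos i x).ne'
  have hn : (0 : ℝ) < Fintype.card α := by exact_mod_cast Fintype.card_pos
  set n : ℝ := (Fintype.card α : ℝ)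
  obtain ⟨y, -, hy⟩ := exists_fixedPoint_stdSimplex (ι := β)
    (f := fun y j => (∑ i, s (n • y) i j) / n)
    (Continuous.continuousOn (continuous_pi fun j => Continuous.div_const
      (continuous_finsetSum _ fun i _ => (hsc i j).comp (continuous_const_smul n)) n))
    (fun y _ => ⟨fun j => div_nonneg (sum_nonneg fun i _ => (hs _ i).1 j) hn.le, by
      rw [← sum_div, sum_comm, sum_congr rfl fun i _ => (hs _ i).2]
      rw [sum_const, card_univ, nsmul_one]
      exact div_self hn.ne'⟩)
  obtain ⟨a, ha, hsum⟩ := exists_pure_rounding (s (n • y)) (hs _)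
  have hx : ∀ j, (n • y) j = ∑ i, s (n • y) i j := fun j => by
    have : (∑ i, s (n • y) i j) / n = y j := congrFun hy j
    rw [Pi.smul_apply, smul_eq_mul, mul_comm, ← this, div_mul_cancel₀ _ hn.ne']
  refine ⟨n • y, a, fun i j => ?_, by simpa only [hx] using hsum⟩
  have h1 := ha i
  rw [hsdef, div_pos_iff_of_pos_right (hwpos i _), hw, lt_max_iff] at h1
  have h2 := h1.resolve_left (lt_irrefl _)
  have h3 := hle i j (n • y)
  linarith

end Rounding

section Games

variable {n k : ℕ} {G : (Fin n → Fin k) → Fin n → ℝ} {L : ℝ}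

theorem actCount_update (a : Fin n → Fin k) (l : Fin n) (j x : Fin k) :
    actCount n k (Function.update a l j) x + (if a l = x then 1 else 0) =
      actCount n k a x + if j = x then 1 else 0 := by
  simp only [actCount, card_filter]
  rw [← add_sum_erase univ _ (mem_univ l), ← add_sum_erase univ (fun i => ite (a i = x) 1 0)
    (mem_univ l), sum_congr rfl fun i hi => by
      rw [Function.update_of_ne (ne_of_mem_erase hi)], Function.update_self]
  ring

theorem sum_actCount (a : Fin n → Fin k) : ∑ j, actCount n k a j = n := by
  simpa [actCount] using
    (card_eq_sum_card_fiberwise (f := a) (s := univ) (t := univ) fun _ _ => mem_univ _).symm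

theorem payoff_sub_le_of_lipschitz (hG : IsAnonymous n k G)
    (hL : ∀ (i l : Fin n) (a : Fin n → Fin k) (j : Fin k), l ≠ i →
      G a i - G (Function.update a l j) i ≤ L)
    (hL0 : 0 ≤ L) (i : Fin n) (a b : Fin n → Fin k) (hab : a i = b i) :
    G a i - G b i ≤ L * (∑ j, (actCount n k a j - actCount n k b j) : ℕ) := by
  induction h : ∑ j, (actCount n k a j - actCount n k b j) using Nat.strong_induction_on
    generalizing a with
  | _ m ih =>
    have hsum : ∑ j, actCount n k a j = ∑ j, actCount n k b j := by rw [sum_actCount, sum_actCount]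
    by_cases hle : ∀ j, actCount n k a j ≤ actCount n k b j
    · have heq := (sum_eq_sum_iff_of_le fun j _ => hle j).1 hsum
      rw [hG a b i hab fun j => heq j (mem_univ j), sub_self]
      positivity
    push Not at hle
    obtain ⟨x, hx⟩ := hle
    obtain ⟨y, hy⟩ : ∃ y, actCount n k a y < actCount n k b y := by
      by_contra! hge
      exact absurd hsum.symm (sum_lt_sum (fun j _ => hge j) ⟨x, mem_univ x, hx⟩).ne
    obtain ⟨l, hli, hlx⟩ : ∃ l, l ≠ i ∧ a l = x := by
      by_contra! hl
      have h1 : (univ.filter fun l => a l = x) ⊆ {i} := fun l hl' => by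
        rw [mem_singleton]
        by_contra hne
        exact hl l hne (mem_filter.1 hl').2
      have h2 : actCount n k a x ≤ 1 := card_le_card h1
      have h3 : actCount n k b x = 0 := by omega
      have h4 : a i ≠ x := fun h => by
        have := card_eq_zero.1 h3
        exact absurd (mem_filter.2 ⟨mem_univ i, hab ▸ h⟩) (this ▸ notMem_empty i)
      have h5 : (univ.filter fun l => a l = x) = ∅ := by
        refine filter_eq_empty_iff.2 fun l _ hlx => ?_
        by_cases hne : l = i
        · exact h4 (hne ▸ hlx)
        · exact hl l hne hlx
      have : actCount n k a x = 0 := by rw [actCount, h5, card_empty]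
      omega
    have hxy : x ≠ y := by rintro rfl; omega
    have hupd := actCount_update a l y
    have hlt : ∑ j, (actCount n k (Function.update a l y) j - actCount n k b j) < m := by
      rw [← h]
      refine sum_lt_sum (fun j _ => ?_) ⟨x, mem_univ x, ?_⟩
      · have := hupd j
        by_cases hjy : y = j
        · subst hjy
          split_ifs at this <;> omega
        · rw [if_neg hjy] at this
          omega
      · have := hupd x
        rw [if_pos hlx, if_neg hxy.symm] at this
        omega
    have h1 := ih _ hlt _ (by rw [Function.update_of_ne hli.symm, hab]) rfl
    have h2 := hL i l a y hli
    have h3 : ((∑ j, (actCount n k (Function.update a l y) j - actCount n k b j) : ℕ) : ℝ) + 1 ≤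
        m := by exact_mod_cast hlt
    nlinarith

theorem payoff_sub_le_sum_abs (hG : IsAnonymous n k G)
    (hL : ∀ (i l : Fin n) (a : Fin n → Fin k) (j : Fin k), l ≠ i →
      G a i - G (Function.update a l j) i ≤ L)
    (hL0 : 0 ≤ L) (i : Fin n) (a b : Fin n → Fin k) (hab : a i = b i) :
    G a i - G b i ≤ L / 2 * ∑ j, |(actCount n k a j : ℝ) - actCount n k b j| := by
  have key : ∀ p q : ℕ, |(p : ℝ) - q| = 2 * ((p - q : ℕ) : ℝ) - (p - q) := by
    intro p q
    rcases le_total p q with h | h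
    · rw [Nat.sub_eq_zero_of_le h, abs_of_nonpos (by simpa using h)]
      simp
    · rw [Nat.cast_sub h, abs_of_nonneg (by simpa using h)]
      ring
  have hsum : ∑ j, |(actCount n k a j : ℝ) - actCount n k b j| =
      2 * (∑ j, (actCount n k a j - actCount n k b j) : ℕ) := by
    simp only [key, sum_sub_distrib, ← mul_sum, ← Nat.cast_sum, sum_actCount]
    simp
  rw [hsum]
  refine (payoff_sub_le_of_lipschitz hG hL hL0 i a b hab).trans_eq ?_
  ring

theorem sum_abs_actCount_update_le (a : Fin n → Fin k) (l : Fin n) (j : Fin k) :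
    ∑ x, |(actCount n k (Function.update a l j) x : ℝ) - actCount n k a x| ≤ 2 := by
  calc ∑ x, |(actCount n k (Function.update a l j) x : ℝ) - actCount n k a x|
      ≤ ∑ x, ((if j = x then (1 : ℝ) else 0) + if a l = x then 1 else 0) := by
        refine sum_le_sum fun x _ => ?_
        have h : (actCount n k (Function.update a l j) x : ℝ) + (if a l = x then 1 else 0) =
            actCount n k a x + if j = x then 1 else 0 := by
          exact_mod_cast actCount_update a l j x
        rw [abs_le]
        split_ifs at h ⊢ <;> constructor <;> linarith
    _ = 2 := by rw [sum_add_distrib]; simp; norm_num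

/-- Extension of player `i`'s payoff from the action `j` to arbitrary vectors of action counts. -/
noncomputable def payoffExtension (L : ℝ) (G : (Fin n → Fin k) → Fin n → ℝ) (i : Fin n) (j : Fin k)
    (x : Fin k → ℝ) : ℝ :=
  (univ : Finset (Fin n → Fin k)).inf' ⟨fun _ => j, mem_univ _⟩ fun b =>
    G (Function.update b i j) i + L / 2 * ∑ l, |x l - actCount n k (Function.update b i j) l|

theorem payoffExtension_continuous (i : Fin n) (j : Fin k) :
    Continuous (payoffExtension L G i j) :=
  Continuous.finset_inf'_apply _ fun _ _ => by fun_prop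

theorem payoffExtension_le_add (hL0 : 0 ≤ L) (i : Fin n) (j : Fin k) (x y : Fin k → ℝ) :
    payoffExtension L G i j x ≤ payoffExtension L G i j y + L / 2 * ∑ l, |x l - y l| := by
  rw [← sub_le_iff_le_add]
  refine le_inf' _ _ fun b hb => ?_
  rw [sub_le_iff_le_add]
  refine (inf'_le _ hb).trans ?_
  rw [add_assoc, ← mul_add, ← sum_add_distrib]
  gcongr with l
  rw [add_comm]
  exact abs_sub_le _ _ _

theorem payoffExtension_actCount (hG : IsAnonymous n k G)
    (hL : ∀ (i l : Fin n) (a : Fin n → Fin k) (j : Fin k), l ≠ i →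
      G a i - G (Function.update a l j) i ≤ L)
    (hL0 : 0 ≤ L) (i : Fin n) (a : Fin n → Fin k) :
    payoffExtension L G i (a i) (fun l => actCount n k a l) = G a i := by
  refine le_antisymm ((inf'_le _ (mem_univ a)).trans_eq (by simp)) (le_inf' _ _ fun b _ => ?_)
  have := payoff_sub_le_sum_abs hG hL hL0 i a (Function.update b i (a i)) (by simp)
  linarith

/-- Every anonymous game in which no player can change another's payoff by more than `L` has a
pure `2 k L`-equilibrium. -/
theorem exists_pure_approx_nash (hk : 1 ≤ k) (hG : IsAnonymous n k G)
    (hL : ∀ (i l : Fin n) (a : Fin n → Fin k) (j : Fin k), l ≠ i →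
      G a i - G (Function.update a l j) i ≤ L)
    (hL0 : 0 ≤ L) :
    ∃ a, ∀ i j, G (Function.update a i j) i ≤ G a i + 2 * k * L := by
  have : NeZero k := ⟨by omega⟩
  by_contra! h
  choose i j hij using h
  obtain ⟨a₀, ha₀⟩ := Finite.exists_min fun a =>
    G (Function.update a (i a) (j a)) (i a) - (G a (i a) + 2 * k * L)
  set η := G (Function.update a₀ (i a₀) (j a₀)) (i a₀) - (G a₀ (i a₀) + 2 * k * L)
  have hη : 0 < η := sub_pos.2 (hij a₀)
  obtain ⟨x, a, hbest, hcount⟩ := exists_near_best_reply_counts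
    (payoffExtension L G) payoffExtension_continuous (half_pos hη)
  have hcount' : ∑ l, |(actCount n k a l : ℝ) - x l| ≤ 2 * (k - 1) := by
    simpa [actCount] using hcount
  have hcount'' : ∑ l, |x l - actCount n k a l| ≤ 2 * ((k : ℝ) - 1) := by
    simpa only [abs_sub_comm] using hcount'
  have h1 := payoffExtension_actCount hG hL hL0 (i a) (Function.update a (i a) (j a))
  rw [Function.update_self] at h1
  have h2 := payoffExtension_le_add (G := G) hL0 (i a) (j a)
    (fun l => actCount n k (Function.update a (i a) (j a)) l) (fun l => actCount n k a l)
  have h3 := payoffExtension_le_add (G := G) hL0 (i a) (j a) (fun l => actCount n k a l) x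
  have h4 := hbest (i a) (j a)
  have h5 := payoffExtension_le_add (G := G) hL0 (i a) (a (i a)) x (fun l => actCount n k a l)
  rw [payoffExtension_actCount hG hL hL0] at h5
  have hL2 : 0 ≤ L / 2 := by positivity
  have h6 := mul_le_mul_of_nonneg_left (sum_abs_actCount_update_le a (i a) (j a)) hL2
  have h7 := mul_le_mul_of_nonneg_left hcount' hL2
  have h8 := mul_le_mul_of_nonneg_left hcount'' hL2
  have h9 := ha₀ a
  linarith

theorem exists_perm_of_actCount_eq {a b : Fin n → Fin k} {i : Fin n} (hi : a i = b i)
    (h : ∀ j, actCount n k a j = actCount n k b j) :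
    ∃ π : Equiv.Perm (Fin n), a = b ∘ π ∧ π i = i := by
  have hfib : ∀ j, Nonempty ({x // a x = j} ≃ {x // b x = j}) := fun j =>
    ⟨Fintype.equivOfCardEq (by simpa [Fintype.card_subtype, actCount] using h j)⟩
  set ρ : Equiv.Perm (Fin n) := (Equiv.sigmaFiberEquiv a).symm.trans
    ((Equiv.sigmaCongrRight fun j => (hfib j).some).trans (Equiv.sigmaFiberEquiv b))
  have hρ : ∀ x, b (ρ x) = a x := fun x => ((hfib (a x)).some ⟨x, rfl⟩).2
  refine ⟨ρ.trans (Equiv.swap (ρ i) i), funext fun x => ?_, by simp⟩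
  rw [Function.comp_apply, Equiv.trans_apply, ← hρ x]
  have hbi : b (ρ i) = b i := (hρ i).trans hi
  by_cases h1 : ρ x = ρ i
  · rw [h1, Equiv.swap_apply_left, hbi]
  · by_cases h2 : ρ x = i
    · rw [h2, Equiv.swap_apply_right, hbi]
    · rw [Equiv.swap_apply_of_ne_of_ne h1 h2]

theorem actCount_comp_perm (c : Fin n → Fin k) (π : Equiv.Perm (Fin n)) (j : Fin k) :
    actCount n k (c ∘ π) j = actCount n k c j :=
  card_equiv π (by simp)

theorem IsAnonymous.perturbGame {g : (Fin n → Fin k) → Fin n → ℝ} (hg : IsAnonymous n k g) (δ : ℝ) :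
    IsAnonymous n k (perturbGame n k δ g) := by
  intro a b i hi hcount
  obtain ⟨π, rfl, hπ⟩ := exists_perm_of_actCount_eq hi hcount
  refine Fintype.sum_equiv (Equiv.arrowCongr π (Equiv.refl _)) _ _ fun c => ?_
  have hc : Equiv.arrowCongr π (Equiv.refl _) c = c ∘ π.symm := rfl
  rw [hc]
  congr 1
  · exact Fintype.prod_equiv π _ _ fun x => by simp
  · refine hg _ _ i ?_ fun j => (actCount_comp_perm c π.symm j).symm
    rw [Function.comp_apply, (Equiv.symm_apply_eq π).2 hπ.symm]

theorem expPay_update (g : (Fin n → Fin k) → Fin n → ℝ) (σ : Fin n → Fin k → ℝ) (i : Fin n)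
    (τ : Fin k → ℝ) :
    expPay n k g (Function.update σ i τ) i =
      ∑ j, τ j * expPay n k g (Function.update σ i (Pi.single j 1)) i := by
  have hprod : ∀ (τ : Fin k → ℝ) (b : Fin n → Fin k),
      ∏ i', Function.update σ i τ i' (b i') = τ (b i) * ∏ i' ∈ univ.erase i, σ i' (b i') := by
    intro τ b
    rw [← mul_prod_erase univ _ (mem_univ i), Function.update_self]
    congr 1
    exact prod_congr rfl fun l hl => by rw [Function.update_of_ne (ne_of_mem_erase hl)]
  simp only [expPay, hprod, mul_sum]
  rw [sum_comm]
  refine sum_congr rfl fun b _ => ?_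
  rw [sum_eq_single (b i) (fun j _ hj => by simp [hj.symm]) (by simp)]
  simp [mul_assoc]

theorem expPay_mem_Icc {g : (Fin n → Fin k) → Fin n → ℝ} (hg : IsGame n k g)
    {σ : Fin n → Fin k → ℝ} (hσ : ∀ i, IsMixed k (σ i)) (i : Fin n) :
    expPay n k g σ i ∈ Set.Icc (0 : ℝ) 1 := by
  have hpos : ∀ b : Fin n → Fin k, 0 ≤ ∏ i', σ i' (b i') := fun b =>
    prod_nonneg fun i' _ => (hσ i').1 _
  have hone : ∑ b : Fin n → Fin k, ∏ i', σ i' (b i') = 1 := by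
    rw [← Fintype.piFinset_univ, ← prod_univ_sum]
    exact prod_eq_one fun i' _ => (hσ i').2
  refine ⟨sum_nonneg fun b _ => mul_nonneg (hpos b) (hg b i).1, ?_⟩
  rw [← hone]
  exact sum_le_sum fun b _ => mul_le_of_le_one_right (hpos b) (hg b i).2

theorem isMixed_single (j : Fin k) : IsMixed k (Pi.single j 1) :=
  ⟨fun l => by by_cases h : l = j <;> simp [h], by simp⟩

theorem isMixed_perturbW {δ : ℝ} (hδ : δ ∈ Set.Ioo (0 : ℝ) 1) (a : Fin k) :
    IsMixed k (perturbW k δ a) := by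
  have hk : (k : ℝ) ≠ 0 := by
    have := a.pos
    positivity
  constructor
  · intro j
    have h1 : 0 ≤ 1 - δ := by linarith [hδ.2]
    have h2 : 0 ≤ δ / k := div_nonneg hδ.1.le k.cast_nonneg
    unfold perturbW
    split_ifs <;> simp <;> linarith
  · simp only [perturbW, sum_add_distrib, ← mul_sum]
    simp
    field_simp
    ring

theorem IsGame.perturbGame {g : (Fin n → Fin k) → Fin n → ℝ} (hg : IsGame n k g) {δ : ℝ}
    (hδ : δ ∈ Set.Ioo (0 : ℝ) 1) : IsGame n k (perturbGame n k δ g) := fun a i =>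
  expPay_mem_Icc hg (fun l => isMixed_perturbW hδ (a l)) i

theorem lipC_nonneg (G : (Fin n → Fin k) → Fin n → ℝ) : 0 ≤ lipC n k G :=
  Real.sSup_nonneg (by rintro _ ⟨i, a, b, -, -, rfl⟩; exact abs_nonneg _)

theorem abs_sub_le_one_of_isGame (hG : IsGame n k G) (i : Fin n) (a b : Fin n → Fin k) :
    |G a i - G b i| ≤ 1 :=
  abs_sub_le_iff.2 ⟨by linarith [(hG a i).2, (hG b i).1], by linarith [(hG b i).2, (hG a i).1]⟩

theorem lipC_le_one (hG : IsGame n k G) : lipC n k G ≤ 1 :=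
  Real.sSup_le (by rintro _ ⟨i, a, b, -, -, rfl⟩; exact abs_sub_le_one_of_isGame hG i a b)
    zero_le_one

theorem sub_update_le_lipC (hG : IsGame n k G) {i l : Fin n} (hli : l ≠ i) (a : Fin n → Fin k)
    (j : Fin k) : G a i - G (Function.update a l j) i ≤ lipC n k G := by
  by_cases hj : a l = j
  · rw [← hj, Function.update_eq_self, sub_self]
    exact lipC_nonneg G
  refine (le_abs_self _).trans (le_csSup ⟨1, ?_⟩ ⟨i, a, _, ?_, ?_, rfl⟩)
  · rintro _ ⟨i, a, b, -, -, rfl⟩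
    exact abs_sub_le_one_of_isGame hG i a b
  · rw [Function.update_of_ne hli.symm]
  · rw [card_eq_one]
    refine ⟨l, ?_⟩
    ext m
    by_cases hm : m = l
    · subst hm; simpa using hj
    · simp [hm]

theorem lam_nonneg (n k : ℕ) (δ : ℝ) : 0 ≤ lam n k δ :=
  Real.sSup_nonneg (by rintro _ ⟨g, -, -, rfl⟩; exact lipC_nonneg _)

theorem lipC_perturbGame_le_lam {g : (Fin n → Fin k) → Fin n → ℝ} (hg : IsGame n k g)
    (hanon : IsAnonymous n k g) {δ : ℝ} (hδ : δ ∈ Set.Ioo (0 : ℝ) 1) :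
    lipC n k (perturbGame n k δ g) ≤ lam n k δ :=
  le_csSup ⟨1, by rintro _ ⟨g, hg, -, rfl⟩; exact lipC_le_one (hg.perturbGame hδ)⟩
    ⟨g, hg, hanon, rfl⟩

theorem perturbGame_update (g : (Fin n → Fin k) → Fin n → ℝ) (δ : ℝ) (a : Fin n → Fin k)
    (i : Fin n) (j : Fin k) :
    perturbGame n k δ g (Function.update a i j) i =
      expPay n k g (Function.update (fun l => perturbW k δ (a l)) i (perturbW k δ j)) i := by
  refine sum_congr rfl fun b _ => ?_
  congr 1
  refine prod_congr rfl fun l _ => ?_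
  by_cases hl : l = i
  · subst hl; simp
  · simp [hl]

/-- Perturbing one's own action costs at most `δ`. -/
theorem expPay_single_le_perturbGame_update {g : (Fin n → Fin k) → Fin n → ℝ} (hg : IsGame n k g)
    {δ : ℝ} (hδ : δ ∈ Set.Ioo (0 : ℝ) 1) (a : Fin n → Fin k) (i : Fin n) (j : Fin k) :
    expPay n k g (Function.update (fun l => perturbW k δ (a l)) i (Pi.single j 1)) i ≤
      perturbGame n k δ g (Function.update a i j) i + δ := by
  rw [perturbGame_update, expPay_update _ _ _ (perturbW k δ j)]
  set h : Fin k → ℝ := fun l =>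
    expPay n k g (Function.update (fun l => perturbW k δ (a l)) i (Pi.single l 1)) i
  have hh : ∀ l, h l ∈ Set.Icc (0 : ℝ) 1 := fun l => by
    refine expPay_mem_Icc hg (fun m => ?_) i
    by_cases hm : m = i
    · subst hm; simpa using isMixed_single l
    · simpa [hm] using isMixed_perturbW hδ (a m)
  have hexp : ∑ l, perturbW k δ j l * h l = (1 - δ) * h j + δ / k * ∑ l, h l := by
    simp only [perturbW, add_mul, sum_add_distrib, mul_assoc, ← mul_sum]
    simp
  have h1 : 0 ≤ δ / k * ∑ l, h l :=
    mul_nonneg (div_nonneg hδ.1.le k.cast_nonneg) (sum_nonneg fun l _ => (hh l).1)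
  have h2 : δ * h j ≤ δ := mul_le_of_le_one_right hδ.1.le (hh j).2
  change h j ≤ ∑ l, perturbW k δ j l * h l + δ
  rw [hexp]
  linarith

end Games

/-- Every `n`-player `k`-action anonymous game admits an `ε`-Nash equilibrium in
`δ`-perturbed pure strategies whenever `ε ≥ δ + 2k·λ(n,k,δ)`. -/
theorem exists_perturbed_pure_epsNash (n k : ℕ) (hk : 1 ≤ k)
    (g : (Fin n → Fin k) → Fin n → ℝ) (hg : IsGame n k g) (hanon : IsAnonymous n k g)
    (δ ε : ℝ) (hδ : δ ∈ Set.Ioo (0 : ℝ) 1) (hε : δ + 2 * k * lam n k δ ≤ ε) :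
    ∃ a : Fin n → Fin k, IsEpsNash n k ε g (fun i => perturbW k δ (a i)) := by
  have hgame := hg.perturbGame hδ
  obtain ⟨a, ha⟩ := exists_pure_approx_nash hk (hanon.perturbGame δ)
    (fun i l a j hli => (sub_update_le_lipC hgame hli a j).trans
      (lipC_perturbGame_le_lam hg hanon hδ)) (lam_nonneg n k δ)
  refine ⟨a, fun i τ hτ => ?_⟩
  have hpure : ∀ j, expPay n k g
      (Function.update (fun l => perturbW k δ (a l)) i (Pi.single j 1)) i ≤
        perturbGame n k δ g a i + ε := fun j => by
    linarith [expPay_single_le_perturbGame_update hg hδ a i j, ha i j]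
  rw [expPay_update, sub_le_iff_le_add]
  calc ∑ j, τ j * expPay n k g (Function.update (fun l => perturbW k δ (a l)) i (Pi.single j 1)) i
      ≤ ∑ j, τ j * (perturbGame n k δ g a i + ε) :=
        sum_le_sum fun j _ => mul_le_mul_of_nonneg_left (hpure j) (hτ.1 j)
    _ = perturbGame n k δ g a i + ε := by rw [← sum_mul, hτ.2, one_mul]
end
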